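/- arXiv:1111.2299 — 3 statements merged into one kernel-verified Lean document; each statement's English description precedes it below -/
import Mathlib

section
/- Let D > 16 be an integer with D ≡ 0, 1 or 4 (mod 8), and assume D ∉ {20, 36, 41, 73, 97, 112, 148, 196, 244, 292, 304, 436, 484, 676, 1684}. Then the set 𝒮_D is nonempty and: if D ≡ 4 (mod 16), 𝒮_D has exactly two components, namely {e ∈ 𝒮_D : e ≡ 2 (mod 8)} and {e ∈ 𝒮_D : e ≡ −2 (mod 8)}; otherwise 𝒮_D has exactly one component. -/
/-- The set `𝒮_D = {e ∈ ℤ : e² ≡ D (mod 8), e² < D and (e+4)² < D}`. -/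
def SD (D : ℤ) : Set ℤ := {e : ℤ | e ^ 2 % 8 = D % 8 ∧ e ^ 2 < D ∧ (e + 4) ^ 2 < D}

/-- The generating relation on `𝒮_D`: `e ∼ -e-4q` whenever `q` is a positive integer
such that `-e-4q ∈ 𝒮_D` and `gcd(q, w) = 1` where `w = (D-e²)/8`. -/
def SMove (D : ℤ) (e e' : ℤ) : Prop :=
  e ∈ SD D ∧ e' ∈ SD D ∧
    ∃ q : ℤ, 0 < q ∧ e' = -e - 4 * q ∧ Int.gcd q ((D - e ^ 2) / 8) = 1


/-- The number of `k < Y` for which no member of `P` divides `a + d * k`. -/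
def siftedCount (P : Finset ℕ) (a d : ℤ) (Y : ℕ) : ℕ :=
  ((Finset.range Y).filter fun k : ℕ => ∀ p ∈ P, ¬ (p : ℤ) ∣ a + d * k).card

theorem siftedCount_insert {P : Finset ℕ} {p k₀ : ℕ} (hp : 0 < p) (a d : ℤ) (Y : ℕ)
    (hk₀ : k₀ < p) (hroot : ∀ k : ℕ, (p : ℤ) ∣ a + d * k ↔ k ≡ k₀ [MOD p]) :
    siftedCount (insert p P) a d Y +
      siftedCount P (a + d * k₀) (d * p) ((Y + (p - 1 - k₀)) / p) = siftedCount P a d Y := by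
  have key : siftedCount P (a + d * k₀) (d * p) ((Y + (p - 1 - k₀)) / p) =
      (((Finset.range Y).filter fun k : ℕ => ∀ r ∈ P, ¬ (r : ℤ) ∣ a + d * k).filter
        fun k : ℕ => (p : ℤ) ∣ a + d * k).card := by
    have hlt : ∀ j, j < (Y + (p - 1 - k₀)) / p ↔ k₀ + p * j < Y := by
      intro j
      rw [← Nat.succ_le_iff, Nat.le_div_iff_mul_le hp, Nat.succ_mul, mul_comm j p]
      omega
    have hval : ∀ j : ℕ, a + d * ((k₀ + p * j : ℕ) : ℤ) = a + d * k₀ + d * p * j := by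
      intro j; push_cast; ring
    refine Finset.card_bij (fun j _ => k₀ + p * j) ?_ ?_ ?_
    · intro j hj
      simp only [Finset.mem_filter, Finset.mem_range] at hj ⊢
      refine ⟨⟨(hlt j).1 hj.1, fun r hr => ?_⟩, ?_⟩
      · rw [hval]; exact hj.2 r hr
      · rw [hroot]; simp [Nat.ModEq]
    · intro i _ j _ hij
      exact Nat.eq_of_mul_eq_mul_left hp (by simpa using hij)
    · intro k hk
      simp only [Finset.mem_filter, Finset.mem_range] at hk
      have hmod := (hroot k).1 hk.2
      have hk' : k₀ + p * (k / p) = k := by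
        have := Nat.mod_add_div k p
        rw [hmod, Nat.mod_eq_of_lt hk₀] at this
        exact this
      refine ⟨k / p, ?_, hk'⟩
      simp only [Finset.mem_filter, Finset.mem_range]
      refine ⟨(hlt _).2 (by rw [hk']; exact hk.1.1), fun r hr => ?_⟩
      rw [← hval, hk']
      exact hk.1.2 r hr
  rw [key, add_comm, siftedCount, siftedCount,
    ← Finset.card_filter_add_card_filter_not (s := Finset.filter
      (fun k : ℕ => ∀ r ∈ P, ¬ (r : ℤ) ∣ a + d * k) (Finset.range Y))
      (fun k : ℕ => (p : ℤ) ∣ a + d * k)]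
  congr 2
  ext k
  simp only [Finset.mem_filter, Finset.mem_range, Finset.forall_mem_insert]
  tauto

theorem exists_root_mod_prime {p : ℕ} (hp : p.Prime) (a : ℤ) {d : ℤ} (hd : ¬ (p : ℤ) ∣ d) :
    ∃ k₀ < p, ∀ k : ℕ, (p : ℤ) ∣ a + d * k ↔ k ≡ k₀ [MOD p] := by
  have := Fact.mk hp
  have hd' : (d : ZMod p) ≠ 0 := by rwa [Ne, ZMod.intCast_zmod_eq_zero_iff_dvd]
  refine ⟨(-(a : ZMod p) / d).val, ZMod.val_lt _, fun k => ?_⟩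
  rw [← ZMod.natCast_eq_natCast_iff, ← ZMod.intCast_zmod_eq_zero_iff_dvd, ZMod.natCast_zmod_val]
  push_cast
  rw [eq_div_iff hd', add_comm, add_eq_zero_iff_eq_neg, mul_comm]

/-- Legendre's sieve for an arithmetic progression. -/
theorem abs_siftedCount_sub_le (P : Finset ℕ) (hP : ∀ p ∈ P, p.Prime) :
    ∀ (a d : ℤ) (Y : ℕ), (∀ p ∈ P, ¬ (p : ℤ) ∣ d) →
      |(siftedCount P a d Y : ℝ) - Y * ∏ p ∈ P, (1 - 1 / (p : ℝ))| ≤ 2 ^ P.card - 1 := by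
  induction P using Finset.induction_on with
  | empty => intro a d Y _; simp [siftedCount]
  | insert p P hpP ih =>
    intro a d Y hd
    rw [Finset.forall_mem_insert] at hP hd
    obtain ⟨hp, hP⟩ := hP
    obtain ⟨hpd, hd⟩ := hd
    obtain ⟨k₀, hk₀, hroot⟩ := exists_root_mod_prime hp a hpd
    have hsplit := siftedCount_insert (P := P) hp.pos a d Y hk₀ hroot
    set Y' := (Y + (p - 1 - k₀)) / p with hY'
    have hdp : ∀ r ∈ P, ¬ (r : ℤ) ∣ d * p := by
      intro r hr h
      rcases (Nat.prime_iff_prime_int.1 (hP r hr)).dvd_or_dvd h with h | h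
      · exact hd r hr h
      · have := (Nat.prime_dvd_prime_iff_eq (hP r hr) hp).1 (by exact_mod_cast h)
        exact hpP (this ▸ hr)
    have h1 := abs_le.1 (ih hP a d Y hd)
    have h2 := abs_le.1 (ih hP (a + d * k₀) (d * p) Y' hdp)
    have hp0 : (0 : ℝ) < p := by exact_mod_cast hp.pos
    have hY1 : (Y' : ℝ) - Y / p ≤ 1 := by
      have : Y' * p ≤ Y + p := (Nat.div_mul_le_self _ _).trans (by omega)
      have : (Y' : ℝ) * p ≤ Y + p := by exact_mod_cast this
      rw [sub_le_iff_le_add, ← mul_le_mul_iff_left₀ hp0, add_mul, div_mul_cancel₀ _ hp0.ne']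
      linarith
    have hY2 : -1 ≤ (Y' : ℝ) - Y / p := by
      have : Y ≤ Y' * p + p := by
        have := Nat.lt_div_mul_add (a := Y + (p - 1 - k₀)) hp.pos
        rw [← hY'] at this
        omega
      have : (Y : ℝ) ≤ Y' * p + p := by exact_mod_cast this
      rw [le_sub_iff_add_le, ← mul_le_mul_iff_left₀ hp0, add_mul, div_mul_cancel₀ _ hp0.ne']
      linarith
    have hfac : ∀ r ∈ P, 0 ≤ 1 - 1 / (r : ℝ) ∧ 1 - 1 / (r : ℝ) ≤ 1 := by
      intro r hr
      have : (1 : ℝ) ≤ r := by exact_mod_cast (hP r hr).one_le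
      have : 1 / (r : ℝ) ≤ 1 := by rw [div_le_one (by linarith)]; exact this
      have : 0 ≤ 1 / (r : ℝ) := by positivity
      constructor <;> linarith
    have hA0 : 0 ≤ ∏ r ∈ P, (1 - 1 / (r : ℝ)) := Finset.prod_nonneg fun r hr => (hfac r hr).1
    have hA1 : ∏ r ∈ P, (1 - 1 / (r : ℝ)) ≤ 1 :=
      Finset.prod_le_one (fun r hr => (hfac r hr).1) fun r hr => (hfac r hr).2
    rw [Finset.prod_insert hpP, Finset.card_insert_of_notMem hpP, pow_succ]
    set A := ∏ r ∈ P, (1 - 1 / (r : ℝ))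
    have hs : (siftedCount (insert p P) a d Y : ℝ) =
        siftedCount P a d Y - siftedCount P (a + d * k₀) (d * p) Y' := by
      rw [← hsplit]; push_cast; ring
    have hm : (Y : ℝ) * ((1 - 1 / (p : ℝ)) * A) = Y * A - Y' * A + (Y' - Y / p) * A := by ring
    have hb1 : ((Y' : ℝ) - Y / p) * A ≤ 1 := by nlinarith
    have hb2 : -1 ≤ ((Y' : ℝ) - Y / p) * A := by nlinarith
    rw [hs, hm, abs_le]
    constructor <;> linarith [h1.1, h1.2, h2.1, h2.2]

theorem forty_eight_mul_prod_le {n : ℕ} (hn : 0 < n) (h48 : 48 ∣ n) :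
    48 * ∏ p ∈ n.primeFactors.filter (5 ≤ ·), p ≤ n := by
  refine Nat.le_of_dvd hn (Nat.Coprime.mul_dvd_of_dvd_of_dvd ?_ h48 ?_)
  · refine Nat.Coprime.prod_right fun p hp => ?_
    rw [Finset.mem_filter, Nat.mem_primeFactors] at hp
    rw [Nat.coprime_comm, hp.1.1.coprime_iff_not_dvd]
    intro h
    rw [show 48 = 2 ^ 4 * 3 by norm_num, hp.1.1.dvd_mul] at h
    rcases h with h | h
    · have := Nat.le_of_dvd (by norm_num) (hp.1.1.dvd_of_dvd_pow h)
      omega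
    · have := Nat.le_of_dvd (by norm_num) h
      omega
  · exact (Finset.prod_dvd_prod_of_subset _ _ _ (Finset.filter_subset _ _)).trans
      (Nat.prod_primeFactors_dvd n)

theorem prod_four_mul_div_sq_le {P : Finset ℕ} (hP : ∀ p ∈ P, 5 ≤ p ∧ p ≠ 6)
    (hsub : {5, 11, 17, 23} ⊆ P) :
    ∏ p ∈ P, (4 * p / (p - 1) ^ 2 : ℝ) ≤ 1 / 30 := by
  rw [← Finset.prod_sdiff hsub]
  have h1 : ∏ p ∈ P \ {5, 11, 17, 23}, (4 * p / (p - 1) ^ 2 : ℝ) ≤ 1 := by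
    refine Finset.prod_le_one (fun p _ => by positivity) fun p hp => ?_
    simp only [Finset.mem_sdiff, Finset.mem_insert, Finset.mem_singleton, not_or] at hp
    have h5 := hP p hp.1
    have h7 : (7 : ℝ) ≤ p := by exact_mod_cast (by omega : 7 ≤ p)
    rw [div_le_one (by nlinarith)]
    nlinarith
  have h2 : ∏ p ∈ ({5, 11, 17, 23} : Finset ℕ), (4 * p / (p - 1) ^ 2 : ℝ) ≤ 1 / 30 := by
    norm_num [Finset.prod_insert]
  calc _ ≤ 1 * ∏ p ∈ ({5, 11, 17, 23} : Finset ℕ), (4 * p / (p - 1) ^ 2 : ℝ) :=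
        mul_le_mul_of_nonneg_right h1 (Finset.prod_nonneg fun p _ => by positivity)
    _ ≤ _ := by rw [one_mul]; exact h2

theorem exists_coprime_of_dvd {n R : ℕ} (hn : 0 < n) (h48 : 48 ∣ n) (hR : 77 ≤ R)
    (hnR : n ≤ (R + 1) ^ 2) (h5 : 5 ∣ n) (h11 : 11 ∣ n) (h17 : 17 ∣ n) (h23 : 23 ∣ n) :
    ∃ q : ℕ, q % 6 = 5 ∧ q.Coprime n ∧ 4 * q + 6 ≤ R := by
  set P := n.primeFactors.filter (5 ≤ ·) with hPdef
  have hP : ∀ p ∈ P, p.Prime ∧ 5 ≤ p := fun p hp => by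
    rw [hPdef, Finset.mem_filter, Nat.mem_primeFactors] at hp
    exact ⟨hp.1.1, hp.2⟩
  have hmem : ∀ p, p.Prime → 5 ≤ p → p ∣ n → p ∈ P := fun p hp h5 hpn => by
    rw [hPdef, Finset.mem_filter, Nat.mem_primeFactors]
    exact ⟨⟨hp, hpn, hn.ne'⟩, h5⟩
  have h6 : ∀ p ∈ P, ¬ (p : ℤ) ∣ 6 := fun p hp h => by
    have h' : p ∣ 2 * 3 := by exact_mod_cast h
    rcases ((hP p hp).1.dvd_mul).1 h' with h | h
    · have := Nat.le_of_dvd (by norm_num) h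
      have := (hP p hp).2
      omega
    · have := Nat.le_of_dvd (by norm_num) h
      have := (hP p hp).2
      omega
  obtain ⟨Y, hYle, hleY⟩ : ∃ Y : ℕ, R ≤ 24 * Y + 25 ∧ 24 * Y + 2 ≤ R :=
    ⟨(R - 2) / 24, by clear * - hR; omega, by clear * - hR; omega⟩
  have hsieve := (abs_le.1 (abs_siftedCount_sub_le P (fun p hp => (hP p hp).1) 5 6 Y h6)).1
  set A := ∏ p ∈ P, (1 - 1 / (p : ℝ)) with hA
  have hA0 : 0 < A := Finset.prod_pos fun p hp => by
    have : (5 : ℝ) ≤ p := by exact_mod_cast (hP p hp).2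
    rw [sub_pos, div_lt_one (by linarith)]
    linarith
  have hsq : ((2 : ℝ) ^ P.card) ^ 2 =
      A ^ 2 * ((∏ p ∈ P, (4 * p / (p - 1) ^ 2 : ℝ)) * ∏ p ∈ P, (p : ℝ)) := by
    rw [hA, ← Finset.prod_const, ← Finset.prod_pow, ← Finset.prod_pow, ← Finset.prod_mul_distrib,
      ← Finset.prod_mul_distrib]
    refine Finset.prod_congr rfl fun p hp => ?_
    have : (5 : ℝ) ≤ p := by exact_mod_cast (hP p hp).2
    have h0 : (p : ℝ) ≠ 0 := by linarith
    have h1 : (p : ℝ) - 1 ≠ 0 := by linarith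
    field_simp
    ring
  have hprod : ∏ p ∈ P, (p : ℝ) ≤ (R + 1) ^ 2 / 48 := by
    have h := (forty_eight_mul_prod_le hn h48).trans hnR
    rw [← hPdef] at h
    have h' := (Nat.cast_le (α := ℝ)).2 h
    push_cast at h'
    linarith
  have hG := prod_four_mul_div_sq_le (P := P)
    (fun p hp => ⟨(hP p hp).2, fun h => by have := (hP p hp).1; rw [h] at this; norm_num at this⟩)
    (by
      intro p hp
      simp only [Finset.mem_insert, Finset.mem_singleton] at hp
      rcases hp with rfl | rfl | rfl | rfl <;> exact hmem _ (by norm_num) (by norm_num) ‹_›)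
  have hT : (2 : ℝ) ^ P.card ≤ A * ((R + 1) / 36) := by
    refine abs_le_of_sq_le_sq' ?_ (by positivity) |>.2
    rw [hsq, mul_pow]
    refine mul_le_mul_of_nonneg_left ?_ (sq_nonneg _)
    calc _ ≤ 1 / 30 * (((R : ℝ) + 1) ^ 2 / 48) :=
          mul_le_mul hG hprod (Finset.prod_nonneg fun p _ => by positivity) (by norm_num)
      _ ≤ _ := by nlinarith [sq_nonneg ((R : ℝ) + 1)]
  have hYR : ((R : ℝ) + 1) / 36 ≤ Y := by
    have h2 : (R : ℝ) ≤ 24 * Y + 25 := by exact_mod_cast hYle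
    have h3 : (77 : ℝ) ≤ R := by exact_mod_cast hR
    linarith
  have hpos : (0 : ℝ) < siftedCount P 5 6 Y := by nlinarith
  have hpos' : 0 < siftedCount P 5 6 Y := by exact_mod_cast hpos
  obtain ⟨k, hk⟩ := Finset.card_pos.1 hpos'
  simp only [Finset.mem_filter, Finset.mem_range] at hk
  obtain ⟨hkY, hk⟩ := hk
  refine ⟨5 + 6 * k, by clear * -; omega, Nat.coprime_of_dvd fun p hp hpq hpn => ?_,
    by clear * - hleY hkY; omega⟩
  by_cases h : 5 ≤ p
  · exact hk p (hmem p hp h hpn) (by exact_mod_cast hpq)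
  · have := hp.two_le
    clear * - this hp h hpq
    interval_cases p
    · omega
    · omega
    · exact absurd hp (by norm_num)

theorem exists_small_coprime {n R : ℕ} (hn : 0 < n) (h48 : 48 ∣ n) (hR : 74 ≤ R)
    (hnR : n ≤ (R + 1) ^ 2) :
    ∃ q : ℕ, q % 6 = 5 ∧ q.Coprime n ∧ 4 * q + 6 ≤ R := by
  by_cases h5 : 5 ∣ n
  swap
  · exact ⟨5, rfl, (Nat.Prime.coprime_iff_not_dvd (by norm_num)).2 h5, by omega⟩
  by_cases h11 : 11 ∣ n
  swap
  · exact ⟨11, rfl, (Nat.Prime.coprime_iff_not_dvd (by norm_num)).2 h11, by omega⟩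
  by_cases h17 : 17 ∣ n
  swap
  · exact ⟨17, rfl, (Nat.Prime.coprime_iff_not_dvd (by norm_num)).2 h17, by omega⟩
  have hR' : 98 ≤ R := by
    have h55 := Nat.Coprime.mul_dvd_of_dvd_of_dvd (by norm_num) h5 h11
    have h935 := Nat.Coprime.mul_dvd_of_dvd_of_dvd (by norm_num) h55 h17
    have := Nat.le_of_dvd hn (Nat.Coprime.mul_dvd_of_dvd_of_dvd (by norm_num) h48 h935)
    clear * - this hnR
    nlinarith
  by_cases h23 : 23 ∣ n
  · exact exists_coprime_of_dvd hn h48 (by linarith) hnR h5 h11 h17 h23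
  · exact ⟨23, rfl, (Nat.Prime.coprime_iff_not_dvd (by norm_num)).2 h23, by linarith⟩

theorem SMove.joined {D e e' : ℤ} (h : SMove D e e') : Relation.EqvGen (SMove D) e e' :=
  .rel _ _ h

theorem reflect_mem_SD {D e : ℤ} (he : e ∈ SD D) : -4 - e ∈ SD D := by
  obtain ⟨h1, h2, h3⟩ := he
  refine ⟨?_, by linarith [show (-4 - e) ^ 2 = (e + 4) ^ 2 by ring],
    by linarith [show (-4 - e + 4) ^ 2 = e ^ 2 by ring]⟩
  have h4 : e % 2 = 0 ∨ e % 2 = 1 := by omega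
  rw [← h1]
  rcases h4 with h4 | h4
  · obtain ⟨k, rfl⟩ : ∃ k, e = 2 * k := ⟨e / 2, by omega⟩
    ring_nf; omega
  · obtain ⟨k, rfl⟩ : ∃ k, e = 2 * k + 1 := ⟨e / 2, by omega⟩
    ring_nf; omega

theorem joined_reflect {D e : ℤ} (he : e ∈ SD D) : Relation.EqvGen (SMove D) e (-4 - e) :=
  SMove.joined ⟨he, reflect_mem_SD he, 1, one_pos, by ring, by simp⟩

theorem joined_add {D e q : ℤ} (he : e ∈ SD D) (he' : e + 4 * (q - 1) ∈ SD D) (hq : 0 < q)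
    (hg : Int.gcd q ((D - e ^ 2) / 8) = 1) :
    Relation.EqvGen (SMove D) e (e + 4 * (q - 1)) := by
  have h := reflect_mem_SD he'
  refine (SMove.joined (e' := -4 - (e + 4 * (q - 1))) ⟨he, h, q, hq, by ring, hg⟩).trans _ _ _ ?_
  simpa using joined_reflect h

theorem joined_sub {D e q : ℤ} (he : e ∈ SD D) (he' : e - 4 * (q - 1) ∈ SD D) (hq : 0 < q)
    (hg : Int.gcd q ((D - (e + 4) ^ 2) / 8) = 1) :
    Relation.EqvGen (SMove D) e (e - 4 * (q - 1)) := by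
  have h : -4 - e + 4 * (q - 1) = -4 - (e - 4 * (q - 1)) := by ring
  have h1 := joined_add (D := D) (e := -4 - e) (q := q) (reflect_mem_SD he)
    (h ▸ reflect_mem_SD he') hq (by rwa [show (-4 - e) ^ 2 = (e + 4) ^ 2 by ring])
  rw [h] at h1
  exact (joined_reflect he).trans _ _ _ (h1.trans _ _ _ ((joined_reflect he').symm _ _))

/-- `R` is the largest integer whose square is less than `D`. -/
def IsRadius (D R : ℤ) : Prop := 0 ≤ R ∧ R ^ 2 < D ∧ D ≤ (R + 1) ^ 2

theorem exists_isRadius {D : ℤ} (hD : 0 < D) : ∃ R, IsRadius D R := by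
  lift D to ℕ using hD.le
  refine ⟨Nat.sqrt (D - 1), by positivity, ?_, ?_⟩
  · have h : Nat.sqrt (D - 1) ^ 2 < D := by have := Nat.sqrt_le' (D - 1); omega
    exact_mod_cast h
  · have := Nat.succ_le_succ_sqrt' (D - 1)
    rw [Nat.sub_add_cancel (by omega)] at this
    exact_mod_cast this

theorem IsRadius.mem_SD_iff {D R e : ℤ} (h : IsRadius D R) :
    e ∈ SD D ↔ e ^ 2 % 8 = D % 8 ∧ -R ≤ e ∧ e ≤ R - 4 := by
  obtain ⟨h0, h1, h2⟩ := h
  have key : ∀ x : ℤ, x ^ 2 < D ↔ -R ≤ x ∧ x ≤ R := fun x =>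
    ⟨fun hx => ⟨by nlinarith, by nlinarith⟩, fun hx => by nlinarith⟩
  simp only [SD, Set.mem_ofPred_eq, key]
  constructor
  · rintro ⟨a, b, c⟩; exact ⟨a, by omega, by omega⟩
  · rintro ⟨a, b, c⟩; exact ⟨a, by omega, by omega⟩

theorem chain_connected {r : ℤ → ℤ → Prop} (hr : Equivalence r) {m a lo hi : ℤ} (hm : 0 < m)
    (h : ∀ x, x % m = a → lo ≤ x → x + m ≤ hi → r x (x + m)) {x y : ℤ}
    (hx : x % m = a) (hy : y % m = a) (hx1 : lo ≤ x) (hx2 : x ≤ hi) (hy1 : lo ≤ y) (hy2 : y ≤ hi) :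
    r x y := by
  wlog hxy : x ≤ y generalizing x y
  · exact hr.symm (this hy hx hy1 hy2 hx1 hx2 (by omega))
  have key : ∀ k : ℕ, x + m * k ≤ hi → r x (x + m * k) := by
    intro k
    induction k with
    | zero => intro _; simpa using hr.refl x
    | succ k ih =>
      intro hk
      have h1 : x + m * ((k + 1 : ℕ) : ℤ) = x + m * k + m := by push_cast; ring
      rw [h1] at hk ⊢
      refine hr.trans (ih (by omega)) (h _ (by simpa using hx) ?_ hk)
      have : 0 ≤ m * (k : ℤ) := by positivity
      omega
  obtain ⟨k, hk⟩ := (Int.ModEq.dvd (hx.trans hy.symm) : m ∣ y - x)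
  lift k to ℕ using by nlinarith
  obtain rfl : y = x + m * k := by omega
  exact key k hy2

theorem sq_emod_three (e : ℤ) : (e % 3 = 0 → e ^ 2 % 3 = 0) ∧ (e % 3 ≠ 0 → e ^ 2 % 3 = 1) := by
  constructor <;> intro h
  · simp [pow_two, Int.mul_emod, h]
  · have : e % 3 = 1 ∨ e % 3 = 2 := by omega
    rcases this with h | h <;> simp [pow_two, Int.mul_emod, h]

theorem gcd_three_div {n : ℤ} (h8 : n % 8 = 0) (h3 : n % 3 ≠ 0) : Int.gcd 3 (n / 8) = 1 := by
  have h : ¬ (3 : ℤ) ∣ n / 8 := by omega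
  exact Int.isCoprime_iff_gcd_eq_one.1 ((Int.prime_three.coprime_iff_not_dvd).2 h)

theorem gcd_nine_div {n : ℤ} (h8 : n % 8 = 0) (h3 : n % 3 ≠ 0) : Int.gcd 9 (n / 8) = 1 := by
  have := Int.isCoprime_iff_gcd_eq_one.2 (gcd_three_div h8 h3)
  exact Int.isCoprime_iff_gcd_eq_one.1 (by simpa using this.pow_left (m := 2))

theorem gcd_two_pow_div {n : ℤ} (h8 : n % 16 = 8) (k : ℕ) : Int.gcd (2 ^ k) (n / 8) = 1 := by
  have h : ¬ (2 : ℤ) ∣ n / 8 := by omega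
  exact Int.isCoprime_iff_gcd_eq_one.1 ((Int.prime_two.coprime_iff_not_dvd).2 h).pow_left

theorem IsRadius.exists_coprime_add {D R e : ℤ} (hR : IsRadius D R) (h74 : 74 ≤ R) (he : e ∈ SD D)
    (he2 : e ≤ -2) (h16 : (D - e ^ 2) % 16 = 0) (h3 : (D - e ^ 2) % 3 = 0) :
    ∃ q : ℤ, 5 ≤ q ∧ q % 6 = 5 ∧ Int.gcd q ((D - e ^ 2) / 8) = 1 ∧ e + 4 * (q - 1) ≤ R - 12 := by
  have hpos : 0 < D - e ^ 2 := by linarith [he.2.1]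
  have hle : D - e ^ 2 ≤ (R + 1) ^ 2 := by linarith [hR.2.2, sq_nonneg e]
  lift R to ℕ using hR.1
  obtain ⟨n, hn⟩ := Int.eq_ofNat_of_zero_le hpos.le
  rw [hn] at h16 h3 hle hpos ⊢
  obtain ⟨q, hq6, hq, hqR⟩ := exists_small_coprime (n := n) (R := R) (by omega) (by omega)
    (by omega) (by exact_mod_cast hle)
  refine ⟨q, by omega, by omega, ?_, by omega⟩
  have : ((n : ℤ) / 8) = ((n / 8 : ℕ) : ℤ) := by push_cast; rfl
  rw [this, Int.gcd_natCast_natCast]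
  exact hq.coprime_dvd_right (Nat.div_dvd_of_dvd (by omega))

theorem IsRadius.exists_coprime_sub {D R e : ℤ} (hR : IsRadius D R) (h74 : 74 ≤ R) (he : e ∈ SD D)
    (he2 : -2 ≤ e) (h16 : (D - (e + 4) ^ 2) % 16 = 0) (h3 : (D - (e + 4) ^ 2) % 3 = 0) :
    ∃ q : ℤ, 5 ≤ q ∧ q % 6 = 5 ∧ Int.gcd q ((D - (e + 4) ^ 2) / 8) = 1 ∧
      -R + 8 ≤ e - 4 * (q - 1) := by
  have hsq : (-4 - e) ^ 2 = (e + 4) ^ 2 := by ring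
  obtain ⟨q, h1, h2, h3, h4⟩ := hR.exists_coprime_add h74 (reflect_mem_SD he) (by omega)
    (by rwa [hsq]) (by rwa [hsq])
  rw [hsq] at h3
  exact ⟨q, h1, h2, h3, by omega⟩

theorem joined_equivalence (D : ℤ) : Equivalence (Relation.EqvGen (SMove D)) :=
  Relation.EqvGen.is_equivalence _

section Even

variable {D R c : ℤ}

theorem joined_add_eight (hR : IsRadius D R)
    (hc : ∀ e, e % 4 = c % 4 → e ^ 2 % 8 = D % 8 ∧ (D - e ^ 2) % 16 = 0) {e : ℤ}
    (he : e % 8 = c) (h3 : (D - e ^ 2) % 3 ≠ 0) (h1 : -R ≤ e) (h2 : e + 8 ≤ R - 4) :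
    Relation.EqvGen (SMove D) e (e + 8) := by
  have h := (hc e (by omega)).2
  exact joined_add (q := 3) (hR.mem_SD_iff.2 ⟨(hc _ (by omega)).1, by omega, by omega⟩)
    (hR.mem_SD_iff.2 ⟨(hc _ (by omega)).1, by omega, by omega⟩) (by norm_num)
    (gcd_three_div (by omega) h3)

theorem joined_add_thirty_two (hR : IsRadius D R)
    (hc : ∀ e, e % 4 = c % 4 → e ^ 2 % 8 = D % 8 ∧ (D - e ^ 2) % 16 = 0) {e : ℤ}
    (he : e % 8 = c) (h3 : (D - e ^ 2) % 3 ≠ 0) (h1 : -R ≤ e) (h2 : e + 32 ≤ R - 4) :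
    Relation.EqvGen (SMove D) e (e + 32) := by
  have h := (hc e (by omega)).2
  exact joined_add (q := 9) (hR.mem_SD_iff.2 ⟨(hc _ (by omega)).1, by omega, by omega⟩)
    (hR.mem_SD_iff.2 ⟨(hc _ (by omega)).1, by omega, by omega⟩) (by norm_num)
    (gcd_nine_div (by omega) h3)

theorem joined_of_good_residue (hR : IsRadius D R)
    (hc : ∀ e, e % 4 = c % 4 → e ^ 2 % 8 = D % 8 ∧ (D - e ^ 2) % 16 = 0) {α : ℤ}
    (hα : ∀ e, e % 3 = α → (D - e ^ 2) % 3 ≠ 0) {e e' : ℤ} (he : e % 8 = c) (he' : e' % 8 = c)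
    (h3 : e % 3 = α) (h3' : e' % 3 = α) (h1 : -R ≤ e) (h2 : e ≤ R - 12) (h1' : -R ≤ e')
    (h2' : e' ≤ R - 12) : Relation.EqvGen (SMove D) e e' := by
  refine chain_connected (joined_equivalence D) (m := 24) (a := (9 * c + 16 * α) % 24) (lo := -R)
    (hi := R - 12) (by norm_num) (fun x hx hx1 hx2 => ?_) (by omega) (by omega) h1 h2 h1' h2'
  have h := joined_add_eight hR hc (e := x + 24) (by omega) (hα _ (by omega)) (by omega) (by omega)
  rw [show x + 24 + 8 = x + 32 by ring] at h
  exact (joined_add_thirty_two hR hc (by omega) (hα _ (by omega)) hx1 (by omega)).trans _ _ _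
    (h.symm _ _)

/-- When `D ≡ 1 (mod 3)`, every prototype is joined to a multiple of `3`. -/
theorem exists_joined_of_emod_three_eq_one (hR : IsRadius D R) (h74 : 74 ≤ R)
    (hc : ∀ e, e % 4 = c % 4 → e ^ 2 % 8 = D % 8 ∧ (D - e ^ 2) % 16 = 0) (hD : D % 3 = 1) {e : ℤ}
    (he : e % 8 = c) (h1 : -R ≤ e) (h2 : e ≤ R - 4) :
    ∃ a, a % 8 = c ∧ a % 3 = 0 ∧ -R ≤ a ∧ a ≤ R - 12 ∧ Relation.EqvGen (SMove D) e a := by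
  have hmem : ∀ x, x % 8 = c → -R ≤ x → x ≤ R - 4 → x ∈ SD D := fun x hx h h' =>
    hR.mem_SD_iff.2 ⟨(hc x (by omega)).1, h, h'⟩
  have hgood : ∀ x : ℤ, x % 3 = 0 → (D - x ^ 2) % 3 ≠ 0 := fun x hx => by
    have := (sq_emod_three x).1 hx; omega
  have hbad : ∀ x : ℤ, x % 3 ≠ 0 → (D - x ^ 2) % 3 = 0 := fun x hx => by
    have := (sq_emod_three x).2 hx; omega
  have hback : ∀ x, x % 8 = c → x % 3 = 2 → -R + 8 ≤ x → x ≤ R - 4 →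
      Relation.EqvGen (SMove D) x (x - 8) := fun x hx hx3 h h' => by
    have := joined_add_eight hR hc (e := x - 8) (by omega) (hgood _ (by omega)) (by omega)
      (by omega)
    rw [sub_add_cancel] at this
    exact this.symm _ _
  have hup : e ≤ -2 → e % 3 ≠ 0 → ∃ x, x % 8 = c ∧ x % 3 = (e + 1) % 3 ∧ -R + 8 ≤ x ∧ x ≤ R - 12 ∧
      Relation.EqvGen (SMove D) e x := fun hle h3 => by
    obtain ⟨q, hq5, hq6, hq, hqR⟩ := hR.exists_coprime_add h74 (hmem e he h1 h2) hle
      (hc e (by omega)).2 (hbad e h3)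
    exact ⟨_, by omega, by omega, by omega, hqR, joined_add (hmem e he h1 h2)
      (hmem _ (by omega) (by omega) (by omega)) (by omega) hq⟩
  have hdown : -2 ≤ e → e % 3 ≠ 2 → ∃ x, x % 8 = c ∧ x % 3 = (e + 2) % 3 ∧ -R + 8 ≤ x ∧
      x ≤ R - 12 ∧ Relation.EqvGen (SMove D) e x := fun hle h3 => by
    obtain ⟨q, hq5, hq6, hq, hqR⟩ := hR.exists_coprime_sub h74 (hmem e he h1 h2) hle
      (hc _ (by omega)).2 (hbad _ (by omega))
    exact ⟨_, by omega, by omega, hqR, by omega, joined_sub (hmem e he h1 h2)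
      (hmem _ (by omega) (by omega) (by omega)) (by omega) hq⟩
  obtain h3 | h3 | h3 : e % 3 = 0 ∨ e % 3 = 1 ∨ e % 3 = 2 := by omega
  · by_cases htop : e ≤ R - 12
    · exact ⟨e, he, h3, h1, htop, .refl _⟩
    · obtain ⟨x, hx8, hx3, hx1, hx2, hx⟩ := hdown (by omega) (by omega)
      exact ⟨x - 8, by omega, by omega, by omega, by omega,
        hx.trans _ _ _ (hback x hx8 (by omega) hx1 (by omega))⟩
  · by_cases hneg : e ≤ -2
    · obtain ⟨x, hx8, hx3, hx1, hx2, hx⟩ := hup hneg (by omega)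
      exact ⟨x - 8, by omega, by omega, by omega, by omega,
        hx.trans _ _ _ (hback x hx8 (by omega) hx1 (by omega))⟩
    · obtain ⟨x, hx8, hx3, hx1, hx2, hx⟩ := hdown (by omega) (by omega)
      exact ⟨x, hx8, by omega, by omega, hx2, hx⟩
  · by_cases hbot : -R + 8 ≤ e
    · exact ⟨e - 8, by omega, by omega, by omega, by omega, hback e he h3 hbot h2⟩
    · obtain ⟨x, hx8, hx3, hx1, hx2, hx⟩ := hup (by omega) (by omega)
      exact ⟨x, hx8, by omega, by omega, hx2, hx⟩

/-- When `3 ∣ D`, every prototype is joined to one that is `2 (mod 3)`. -/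
theorem exists_joined_of_emod_three_eq_zero (hR : IsRadius D R) (h74 : 74 ≤ R)
    (hc : ∀ e, e % 4 = c % 4 → e ^ 2 % 8 = D % 8 ∧ (D - e ^ 2) % 16 = 0) (hD : D % 3 = 0) {e : ℤ}
    (he : e % 8 = c) (h1 : -R ≤ e) (h2 : e ≤ R - 4) :
    ∃ a, a % 8 = c ∧ a % 3 = 2 ∧ -R ≤ a ∧ a ≤ R - 12 ∧ Relation.EqvGen (SMove D) e a := by
  have hmem : ∀ x, x % 8 = c → -R ≤ x → x ≤ R - 4 → x ∈ SD D := fun x hx h h' =>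
    hR.mem_SD_iff.2 ⟨(hc x (by omega)).1, h, h'⟩
  have hgood : ∀ x : ℤ, x % 3 ≠ 0 → (D - x ^ 2) % 3 ≠ 0 := fun x hx => by
    have := (sq_emod_three x).2 hx; omega
  have hbad : ∀ x : ℤ, x % 3 = 0 → (D - x ^ 2) % 3 = 0 := fun x hx => by
    have := (sq_emod_three x).1 hx; omega
  have hback : ∀ x, x % 8 = c → x % 3 ≠ 2 → -R + 8 ≤ x → x ≤ R - 4 →
      Relation.EqvGen (SMove D) x (x - 8) := fun x hx hx3 h h' => by
    have := joined_add_eight hR hc (e := x - 8) (by omega) (hgood _ (by omega)) (by omega)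
      (by omega)
    rw [sub_add_cancel] at this
    exact this.symm _ _
  have hone : ∀ x, x % 8 = c → x % 3 = 1 → -R ≤ x → x ≤ R - 4 →
      ∃ a, a % 8 = c ∧ a % 3 = 2 ∧ -R ≤ a ∧ a ≤ R - 12 ∧ Relation.EqvGen (SMove D) x a := by
    intro x hx hx3 h h'
    by_cases hbot : -R + 8 ≤ x
    · exact ⟨x - 8, by omega, by omega, by omega, by omega, hback x hx (by omega) hbot h'⟩
    · refine ⟨x + 16, by omega, by omega, by omega, by omega, ?_⟩
      have e1 := joined_add_thirty_two hR hc hx (hgood x (by omega)) h (by omega)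
      have e2 := hback (x + 32) (by omega) (by omega) (by omega) (by omega)
      have e3 := hback (x + 24) (by omega) (by omega) (by omega) (by omega)
      rw [show x + 32 - 8 = x + 24 by ring] at e2
      rw [show x + 24 - 8 = x + 16 by ring] at e3
      exact e1.trans _ _ _ (e2.trans _ _ _ e3)
  obtain h3 | h3 | h3 : e % 3 = 0 ∨ e % 3 = 1 ∨ e % 3 = 2 := by omega
  · by_cases hbot : -R + 8 ≤ e
    · obtain ⟨a, ha8, ha3, ha1, ha2, ha⟩ := hone (e - 8) (by omega) (by omega) (by omega) (by omega)
      exact ⟨a, ha8, ha3, ha1, ha2, (hback e he (by omega) hbot h2).trans _ _ _ ha⟩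
    · obtain ⟨q, hq5, hq6, hq, hqR⟩ := hR.exists_coprime_add h74 (hmem e he h1 h2) (by omega)
        (hc e (by omega)).2 (hbad e h3)
      have hx := joined_add (hmem e he h1 h2) (hmem (e + 4 * (q - 1)) (by omega) (by omega)
        (by omega)) (by omega) hq
      exact ⟨e + 4 * (q - 1) - 8, by omega, by omega, by omega, by omega,
        hx.trans _ _ _ (hback _ (by omega) (by omega) (by omega) (by omega))⟩
  · exact hone e he h3 h1 h2
  · by_cases htop : e ≤ R - 12
    · exact ⟨e, he, h3, h1, htop, .refl _⟩
    · obtain ⟨q, hq5, hq6, hq, hqR⟩ := hR.exists_coprime_sub h74 (hmem e he h1 h2) (by omega)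
        (hc _ (by omega)).2 (hbad _ (by omega))
      have hx := joined_sub (hmem e he h1 h2) (hmem (e - 4 * (q - 1)) (by omega) (by omega)
        (by omega)) (by omega) hq
      exact ⟨e - 4 * (q - 1) - 8, by omega, by omega, by omega, by omega,
        hx.trans _ _ _ (hback _ (by omega) (by omega) (by omega) (by omega))⟩

theorem joined_of_emod_eight_eq (hR : IsRadius D R) (h74 : 74 ≤ R)
    (hc : ∀ e, e % 4 = c % 4 → e ^ 2 % 8 = D % 8 ∧ (D - e ^ 2) % 16 = 0) {e e' : ℤ}
    (he : e % 8 = c) (he' : e' % 8 = c) (h1 : -R ≤ e) (h2 : e ≤ R - 4) (h1' : -R ≤ e')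
    (h2' : e' ≤ R - 4) : Relation.EqvGen (SMove D) e e' := by
  obtain hD | hD | hD : D % 3 = 0 ∨ D % 3 = 1 ∨ D % 3 = 2 := by omega
  · obtain ⟨a, ha8, ha3, ha1, ha2, ha⟩ :=
      exists_joined_of_emod_three_eq_zero hR h74 hc hD he h1 h2
    obtain ⟨b, hb8, hb3, hb1, hb2, hb⟩ :=
      exists_joined_of_emod_three_eq_zero hR h74 hc hD he' h1' h2'
    refine ha.trans _ _ _ (.trans _ _ _ ?_ (hb.symm _ _))
    exact joined_of_good_residue hR hc (fun x hx => by
      have := (sq_emod_three x).2 (by omega); omega) ha8 hb8 ha3 hb3 ha1 ha2 hb1 hb2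
  · obtain ⟨a, ha8, ha3, ha1, ha2, ha⟩ :=
      exists_joined_of_emod_three_eq_one hR h74 hc hD he h1 h2
    obtain ⟨b, hb8, hb3, hb1, hb2, hb⟩ :=
      exists_joined_of_emod_three_eq_one hR h74 hc hD he' h1' h2'
    refine ha.trans _ _ _ (.trans _ _ _ ?_ (hb.symm _ _))
    exact joined_of_good_residue hR hc (fun x hx => by
      have := (sq_emod_three x).1 hx; omega) ha8 hb8 ha3 hb3 ha1 ha2 hb1 hb2
  · refine chain_connected (joined_equivalence D) (m := 8) (lo := -R) (hi := R - 4) (by norm_num)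
      (fun x hx hx1 hx2 => joined_add_eight hR hc hx ?_ hx1 hx2) he he' h1 h2 h1' h2'
    have := sq_emod_three x
    omega

end Even

section Odd

variable {D R a : ℤ}

theorem joined_of_emod_four_eq (hR : IsRadius D R) (h74 : 74 ≤ R) (ha : 0 ≤ a ∧ a < 8)
    (hgood : ∀ e, e % 8 = a → e ^ 2 % 8 = D % 8 ∧ (D - e ^ 2) % 16 = 8)
    (hbad : ∀ e, e % 8 = (a + 4) % 8 → e ^ 2 % 8 = D % 8 ∧ (D - e ^ 2) % 16 = 0) {e e' : ℤ}
    (he : e % 4 = a % 4) (he' : e' % 4 = a % 4) (h1 : -R ≤ e) (h2 : e ≤ R - 4) (h1' : -R ≤ e')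
    (h2' : e' ≤ R - 4) : Relation.EqvGen (SMove D) e e' := by
  have hmem : ∀ x, x % 4 = a % 4 → -R ≤ x → x ≤ R - 4 → x ∈ SD D := fun x hx h h' => by
    refine hR.mem_SD_iff.2 ⟨?_, h, h'⟩
    obtain hx | hx : x % 8 = a ∨ x % 8 = (a + 4) % 8 := by omega
    exacts [(hgood x hx).1, (hbad x hx).1]
  have h4 : ∀ x, x % 8 = a → -R ≤ x → x + 4 ≤ R - 4 → Relation.EqvGen (SMove D) x (x + 4) :=
    fun x hx h h' => joined_add (q := 2) (hmem x (by omega) h (by omega))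
      (hmem _ (by omega) (by omega) (by omega)) (by norm_num)
      (by simpa using gcd_two_pow_div (hgood x hx).2 1)
  have h12 : ∀ x, x % 8 = a → -R ≤ x → x + 12 ≤ R - 4 → Relation.EqvGen (SMove D) x (x + 12) :=
    fun x hx h h' => joined_add (q := 4) (hmem x (by omega) h (by omega))
      (hmem _ (by omega) (by omega) (by omega)) (by norm_num)
      (by simpa using gcd_two_pow_div (hgood x hx).2 2)
  have hchain : ∀ x y, x % 8 = a → y % 8 = a → -R ≤ x → x ≤ R - 8 → -R ≤ y → y ≤ R - 8 →
      Relation.EqvGen (SMove D) x y := by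
    intro x y hx hy hx1 hx2 hy1 hy2
    refine chain_connected (joined_equivalence D) (m := 8) (lo := -R) (hi := R - 8) (by norm_num)
      (fun z hz hz1 hz2 => ?_) hx hy hx1 hx2 hy1 hy2
    have := h4 (z + 8) (by omega) (by omega) (by omega)
    rw [show z + 8 + 4 = z + 12 by ring] at this
    exact (h12 z hz hz1 (by omega)).trans _ _ _ (this.symm _ _)
  have hback : ∀ x, x % 8 = (a + 4) % 8 → -R + 4 ≤ x → x ≤ R - 4 →
      Relation.EqvGen (SMove D) x (x - 4) := fun x hx h h' => by
    have := h4 (x - 4) (by omega) (by omega) (by omega)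
    rw [sub_add_cancel] at this
    exact this.symm _ _
  have hattach : ∀ x, x % 4 = a % 4 → -R ≤ x → x ≤ R - 4 →
      ∃ b, b % 8 = a ∧ -R ≤ b ∧ b ≤ R - 8 ∧ Relation.EqvGen (SMove D) x b := by
    intro x hx hx1 hx2
    have hxm := hmem x hx hx1 hx2
    obtain hx8 | hx8 : x % 8 = a ∨ x % 8 = (a + 4) % 8 := by omega
    · by_cases htop : x ≤ R - 8
      · exact ⟨x, hx8, hx1, htop, .refl _⟩
      · have hw := (hbad (x + 4) (by omega)).2
        by_cases h3 : (D - (x + 4) ^ 2) % 3 = 0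
        · obtain ⟨q, hq5, hq6, hq, hqR⟩ := hR.exists_coprime_sub h74 hxm (by omega) hw h3
          exact ⟨_, by omega, by omega, by omega, joined_sub hxm
            (hmem _ (by omega) (by omega) (by omega)) (by omega) hq⟩
        · exact ⟨_, by omega, by omega, by omega, joined_sub (q := 3) hxm
            (hmem _ (by omega) (by omega) (by omega)) (by omega)
            (gcd_three_div (by omega) h3)⟩
    · by_cases hbot : -R + 4 ≤ x
      · exact ⟨x - 4, by omega, by omega, by omega, hback x hx8 hbot hx2⟩
      · have hw := (hbad x hx8).2
        by_cases h3 : (D - x ^ 2) % 3 = 0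
        · obtain ⟨q, hq5, hq6, hq, hqR⟩ := hR.exists_coprime_add h74 hxm (by omega) hw h3
          exact ⟨x + 4 * (q - 1) - 4, by omega, by omega, by omega, (joined_add hxm
            (hmem _ (by omega) (by omega) (by omega)) (by omega) hq).trans _ _ _
            (hback _ (by omega) (by omega) (by omega))⟩
        · exact ⟨x + 4 * (3 - 1) - 4, by omega, by omega, by omega, (joined_add (q := 3) hxm
            (hmem _ (by omega) (by omega) (by omega)) (by omega)
            (gcd_three_div (by omega) h3)).trans _ _ _
            (hback _ (by omega) (by omega) (by omega))⟩
  obtain ⟨b, hb8, hb1, hb2, hb⟩ := hattach e he h1 h2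
  obtain ⟨b', hb8', hb1', hb2', hb'⟩ := hattach e' he' h1' h2'
  exact hb.trans _ _ _ ((hchain b b' hb8 hb8' hb1 hb2 hb1' hb2').trans _ _ _ (hb'.symm _ _))

end Odd

theorem sq_emod_sixteen (e : ℤ) :
    (e % 4 = 0 → e ^ 2 % 16 = 0) ∧ (e % 4 = 2 → e ^ 2 % 16 = 4) ∧
    (e % 8 = 1 ∨ e % 8 = 7 → e ^ 2 % 16 = 1) ∧ (e % 8 = 3 ∨ e % 8 = 5 → e ^ 2 % 16 = 9) := by
  obtain ⟨k, r, hr, rfl⟩ : ∃ k r : ℤ, (0 ≤ r ∧ r < 8) ∧ e = 8 * k + r :=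
    ⟨e / 8, e % 8, by omega, by omega⟩
  have h : (8 * k + r) ^ 2 % 16 = r ^ 2 % 16 := by
    rw [show (8 * k + r) ^ 2 = r ^ 2 + 16 * (4 * k ^ 2 + k * r) by ring, Int.add_mul_emod_self_left]
  rw [h]
  obtain ⟨h0, h8⟩ := hr
  interval_cases r <;> omega

theorem emod_four_eq_zero {D e : ℤ} (hD : D % 8 = 0) (he : e ^ 2 % 8 = D % 8) : e % 4 = 0 := by
  have := sq_emod_sixteen e
  omega

theorem emod_four_eq_two {D e : ℤ} (hD : D % 8 = 4) (he : e ^ 2 % 8 = D % 8) : e % 4 = 2 := by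
  have := sq_emod_sixteen e
  omega

theorem emod_two_eq_one {D e : ℤ} (hD : D % 8 = 1) (he : e ^ 2 % 8 = D % 8) : e % 2 = 1 := by
  have := sq_emod_sixteen e
  omega

theorem joined_of_unramified {D R : ℤ} (hR : IsRadius D R) (hD : D % 16 = 8 ∨ D % 16 = 12)
    {e e' : ℤ} (he : e ∈ SD D) (he' : e' ∈ SD D) : Relation.EqvGen (SMove D) e e' := by
  have h := hR.mem_SD_iff.1 he
  have h' := hR.mem_SD_iff.1 he'
  obtain ⟨a, ha, hsq⟩ : ∃ a : ℤ, (∀ x : ℤ, x ^ 2 % 8 = D % 8 → x % 4 = a) ∧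
      ∀ x : ℤ, x % 4 = a → x ^ 2 % 16 = (D + 8) % 16 := by
    obtain hD | hD := hD
    · exact ⟨0, fun x => emod_four_eq_zero (by omega),
        fun x hx => by rw [(sq_emod_sixteen x).1 hx]; omega⟩
    · exact ⟨2, fun x => emod_four_eq_two (by omega),
        fun x hx => by rw [(sq_emod_sixteen x).2.1 hx]; omega⟩
  refine chain_connected (joined_equivalence D) (m := 4) (a := a) (lo := -R) (hi := R - 4)
    (by norm_num) (fun x hx hx1 hx2 => ?_) (ha e h.1) (ha e' h'.1) h.2.1 h.2.2 h'.2.1 h'.2.2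
  have hx' := hsq x hx
  have hx4 := hsq (x + 4) (by rw [Int.add_emod_right, hx])
  exact joined_add (q := 2) (hR.mem_SD_iff.2 ⟨by omega, by omega, by omega⟩)
    (hR.mem_SD_iff.2 ⟨by norm_num; omega, by omega, by omega⟩) (by norm_num)
    (by simpa using gcd_two_pow_div (n := D - x ^ 2) (by omega) 1)

theorem joined_of_odd {D R : ℤ} (hR : IsRadius D R) (h74 : 74 ≤ R) (hD : D % 8 = 1) {e e' : ℤ}
    (he : e ∈ SD D) (he' : e' ∈ SD D) : Relation.EqvGen (SMove D) e e' := by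
  have key : ∀ x, x ∈ SD D → ∃ y ∈ SD D, y % 4 = 1 ∧ Relation.EqvGen (SMove D) x y := by
    intro x hx
    have hx2 := emod_two_eq_one hD hx.1
    obtain hx4 | hx4 : x % 4 = 1 ∨ x % 4 = 3 := by omega
    · exact ⟨x, hx, hx4, .refl _⟩
    · exact ⟨_, reflect_mem_SD hx, by omega, joined_reflect hx⟩
  obtain ⟨y, hy, hy4, hey⟩ := key e he
  obtain ⟨y', hy', hy4', hey'⟩ := key e' he'
  refine hey.trans _ _ _ (.trans _ _ _ ?_ (hey'.symm _ _))
  have hy := (hR.mem_SD_iff.1 hy).2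
  have hy' := (hR.mem_SD_iff.1 hy').2
  have h1 : ∀ x : ℤ, x % 8 = 1 → x ^ 2 % 16 = 1 := fun x hx => (sq_emod_sixteen x).2.2.1 (.inl hx)
  have h5 : ∀ x : ℤ, x % 8 = 5 → x ^ 2 % 16 = 9 := fun x hx => (sq_emod_sixteen x).2.2.2 (.inr hx)
  obtain hD | hD : D % 16 = 1 ∨ D % 16 = 9 := by omega
  · refine joined_of_emod_four_eq hR h74 (a := 5) (by norm_num) (fun x hx => ?_) (fun x hx => ?_)
      hy4 hy4' hy.1 hy.2 hy'.1 hy'.2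
    · have := h5 x hx
      omega
    · have := h1 x hx
      omega
  · refine joined_of_emod_four_eq hR h74 (a := 1) (by norm_num) (fun x hx => ?_) (fun x hx => ?_)
      hy4 hy4' hy.1 hy.2 hy'.1 hy'.2
    · have := h1 x hx
      omega
    · have := h5 x hx
      omega

theorem joined_of_ramified {D R : ℤ} (hR : IsRadius D R) (h74 : 74 ≤ R)
    (hD : D % 16 = 0 ∨ D % 16 = 4) {e e' : ℤ} (he : e ∈ SD D) (he' : e' ∈ SD D)
    (h8 : D % 16 = 4 → e % 8 = e' % 8) : Relation.EqvGen (SMove D) e e' := by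
  have h := (hR.mem_SD_iff.1 he).2
  have hsq : ∀ x : ℤ, x % 4 = e % 4 → x ^ 2 % 16 = D % 16 := fun x hx => by
    obtain hD | hD := hD
    · have := emod_four_eq_zero (by omega) he.1
      rw [(sq_emod_sixteen x).1 (hx.trans this), hD]
    · have := emod_four_eq_two (by omega) he.1
      rw [(sq_emod_sixteen x).2.1 (hx.trans this), hD]
  have hsame : ∀ x, x ∈ SD D → x % 8 = e % 8 → Relation.EqvGen (SMove D) e x := by
    intro x hx hx8
    have hx' := (hR.mem_SD_iff.1 hx).2
    refine joined_of_emod_eight_eq hR h74 (c := e % 8) (fun y hy => ?_) rfl hx8 h.1 h.2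
      hx'.1 hx'.2
    have := hsq y (by omega)
    omega
  by_cases hee : e' % 8 = e % 8
  · exact hsame e' he' hee
  · have h0 : D % 8 = 0 := by omega
    have he4 := emod_four_eq_zero h0 he.1
    have he4' := emod_four_eq_zero h0 he'.1
    exact (hsame _ (reflect_mem_SD he') (by omega)).trans _ _ _ ((joined_reflect he').symm _ _)

theorem joined_of_large {D R : ℤ} (hR : IsRadius D R) (h74 : 74 ≤ R)
    (hmod : D % 8 = 0 ∨ D % 8 = 1 ∨ D % 8 = 4) {e e' : ℤ} (he : e ∈ SD D) (he' : e' ∈ SD D)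
    (h8 : D % 16 = 4 → e % 8 = e' % 8) : Relation.EqvGen (SMove D) e e' := by
  by_cases hu : D % 16 = 8 ∨ D % 16 = 12
  · exact joined_of_unramified hR hu he he'
  by_cases hodd : D % 8 = 1
  · exact joined_of_odd hR h74 hodd he he'
  · exact joined_of_ramified hR h74 (by omega) he he' h8

/-- Whether bit `u` of `m` is set. Bit `u` stands for the prototype `u - 80`. -/
def hasBit (m u : ℕ) : Bool := ((m >>> u) % 2).beq 1

/-- Whether the prototype `80 - s` with invariant `w` has a move with parameter in the given list
to a prototype in `m`. -/
def joins (w m s : ℕ) : List ℕ → Bool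
  | [] => false
  | q :: l => (4 * q).ble s && hasBit m (s - 4 * q) && (q.gcd w).beq 1 || joins w m s l

/-- The value `f n`, by a case distinction that makes the kernel evaluate `n` first. -/
def evalArg {α : Type} (f : ℕ → α) : ℕ → α
  | 0 => f 0
  | n + 1 => f (n + 1)

/-- Add to `m`, one after another, the prototypes of the given list that have a move to `m`. -/
def sweep (D : ℕ) : List ℕ → ℕ → ℕ
  | [], m => m
  | u :: l, m => evalArg (sweep D l) <|
    bif !hasBit m u && joins ((D + 160 * u - (u * u + 6400)) / 8) m (160 - u)
      [1, 2, 3, 4, 5, 7, 9, 11, 13, 17] then m ||| 1 <<< u else m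

/-- The codes of the prototypes congruent to `r - 80` modulo a divisor `c` of `160`. -/
def codes (D r c : ℕ) : List ℕ :=
  ((List.range (160 / c)).map fun k => c * k + r % c).filter fun u =>
    (u * u + 6401).ble (D + 160 * u) && (u * u + 5777).ble (D + 152 * u) &&
    ((D + 160 * u - (u * u + 6400)) % 8).beq 0

/-- Whether three sweeps join every prototype congruent to `r - 80` modulo `c` to `r - 80`. -/
def sweepsJoinAll (D r c : ℕ) : Bool :=
  let L := (codes D r c).reverse
  let m := sweep D L (sweep D L (sweep D L (1 <<< r)))
  L.all fun u => hasBit m u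

/-- The discriminants excluded from the classification of components. -/
def exceptional : List ℕ :=
  [20, 36, 41, 73, 97, 112, 148, 196, 244, 292, 304, 436, 484, 676, 1684]

/-- Whether the sweeps succeed for all nonexceptional `D ≡ 0, 1, 4, 9 (mod 16)` with
`D / 16 = i`. -/
def blockJoined (i : ℕ) : Bool :=
  (exceptional.elem (16 * i) || sweepsJoinAll (16 * i) 80 4) &&
  (exceptional.elem (16 * i + 1) || sweepsJoinAll (16 * i + 1) 79 2) &&
  (exceptional.elem (16 * i + 9) || sweepsJoinAll (16 * i + 9) 79 2) &&
  (exceptional.elem (16 * i + 4) ||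
    sweepsJoinAll (16 * i + 4) 78 8 && sweepsJoinAll (16 * i + 4) 82 8)

theorem hasBit_eq_testBit (m u : ℕ) : hasBit m u = m.testBit u := by
  rw [Nat.testBit_eq_decide_div_mod_eq, hasBit, Nat.shiftRight_eq_div_pow, Bool.eq_iff_iff]
  simp

theorem evalArg_eq {α : Type} (f : ℕ → α) (n : ℕ) : evalArg f n = f n := by
  cases n <;> rfl

theorem joins_iff {w m s : ℕ} {l : List ℕ} :
    joins w m s l = true ↔
      ∃ q ∈ l, 4 * q ≤ s ∧ hasBit m (s - 4 * q) = true ∧ q.gcd w = 1 := by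
  induction l with
  | nil => simp [joins]
  | cons q l ih => simp [joins, ih, and_assoc]

theorem mem_codes_iff {D r c u : ℕ} (hc : c ∣ 160) :
    u ∈ codes D r c ↔ u < 160 ∧ u % c = r % c ∧ ((u : ℤ) - 80) ∈ SD D := by
  have key : (((u : ℤ) - 80) ∈ SD D) ↔ u * u + 6400 < D + 160 * u ∧ u * u + 5776 < D + 152 * u ∧
      (D + 160 * u - (u * u + 6400)) % 8 = 0 := by
    have h1 : ((u : ℤ) - 80) ^ 2 = u * u - 160 * u + 6400 := by ring
    have h2 : ((u : ℤ) - 80 + 4) ^ 2 = u * u - 152 * u + 5776 := by ring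
    have h3 : (u : ℤ) * u = ((u * u : ℕ) : ℤ) := by push_cast; rfl
    simp only [SD, Set.mem_ofPred_eq, h1, h2, h3]
    generalize u * u = v
    omega
  have hc0 : 0 < c := Nat.pos_of_dvd_of_pos hc (by norm_num)
  have hrange : (∃ k < 160 / c, c * k + r % c = u) ↔ u < 160 ∧ u % c = r % c := by
    constructor
    · rintro ⟨k, hk, rfl⟩
      have hr := Nat.mod_lt r hc0
      refine ⟨?_, by simp⟩
      calc c * k + r % c < c * (k + 1) := by rw [mul_add, mul_one]; omega
        _ ≤ c * (160 / c) := Nat.mul_le_mul_left c hk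
        _ = 160 := Nat.mul_div_cancel' hc
    · rintro ⟨hu, hur⟩
      exact ⟨u / c, Nat.div_lt_div_of_lt_of_dvd hc hu, by rw [← hur, Nat.div_add_mod]⟩
  rw [key, ← and_assoc, ← hrange]
  simp [codes, and_assoc, Nat.succ_le_iff]

theorem natCast_invariant {D u : ℕ} (h : ((u : ℤ) - 80) ^ 2 < D) :
    (((D + 160 * u - (u * u + 6400)) / 8 : ℕ) : ℤ) = ((D : ℤ) - ((u : ℤ) - 80) ^ 2) / 8 := by
  have h1 : ((u : ℤ) - 80) ^ 2 = ((u * u : ℕ) : ℤ) - 160 * u + 6400 := by push_cast; ring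
  rw [h1] at h ⊢
  generalize u * u = v at *
  omega

/-- All members of `m` are prototypes joined to `e`. -/
def JoinedTo (D e : ℤ) (m : ℕ) : Prop :=
  ∀ u, hasBit m u = true → (u : ℤ) - 80 ∈ SD D ∧ Relation.EqvGen (SMove D) e (u - 80)

theorem JoinedTo.sweep {D : ℕ} {e : ℤ} {L : List ℕ}
    (hL : ∀ u ∈ L, u < 160 ∧ ((u : ℤ) - 80) ∈ SD D) :
    ∀ {m : ℕ}, JoinedTo D e m → JoinedTo D e (sweep D L m) := by
  induction L with
  | nil => intro m hm; exact hm
  | cons u L ih =>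
    intro m hm
    rw [List.forall_mem_cons] at hL
    obtain ⟨⟨hu, huD⟩, hL⟩ := hL
    rw [_root_.sweep, evalArg_eq]
    refine ih hL ?_
    rw [cond_eq_ite]
    split_ifs with hj
    · rw [Bool.and_eq_true, joins_iff] at hj
      obtain ⟨-, q, hq, hqs, hbit, hg⟩ := hj
      have hq0 : 0 < q := Nat.pos_of_ne_zero fun h => by simp [h] at hq
      obtain ⟨htD, ht⟩ := hm _ hbit
      have hcast : ((160 - u - 4 * q : ℕ) : ℤ) - 80 = -((u : ℤ) - 80) - 4 * q := by omega
      rw [hcast] at htD ht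
      have hmove : SMove D ((u : ℤ) - 80) (-((u : ℤ) - 80) - 4 * q) := by
        refine ⟨huD, htD, q, by omega, rfl, ?_⟩
        rw [← natCast_invariant huD.2.1, Int.gcd_natCast_natCast]
        exact hg
      intro v hv
      rw [hasBit_eq_testBit, Nat.testBit_or, Bool.or_eq_true, Nat.one_shiftLeft,
        Nat.testBit_two_pow, decide_eq_true_iff] at hv
      rcases hv with hv | rfl
      · exact hm v (by rwa [hasBit_eq_testBit])
      · exact ⟨huD, ht.trans _ _ _ (hmove.joined.symm _ _)⟩
    · exact hm

theorem joined_of_sweepsJoinAll {D r c : ℕ} (hdvd : c ∣ 160) (h : sweepsJoinAll D r c = true)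
    (hr : (r : ℤ) - 80 ∈ SD D) {e : ℤ} (he : e ∈ SD D) (h1 : -80 ≤ e) (h2 : e < 80)
    (hc : (e + 80) % c = r % c) : Relation.EqvGen (SMove D) (r - 80) e := by
  have hL : ∀ u ∈ (codes D r c).reverse, u < 160 ∧ ((u : ℤ) - 80) ∈ SD D := fun u hu => by
    rw [List.mem_reverse, mem_codes_iff hdvd] at hu
    exact ⟨hu.1, hu.2.2⟩
  have h0 : JoinedTo D (r - 80) (1 <<< r) := fun u hu => by
    rw [hasBit_eq_testBit, Nat.one_shiftLeft, Nat.testBit_two_pow, decide_eq_true_iff] at hu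
    subst hu
    exact ⟨hr, .refl _⟩
  obtain ⟨u, hu⟩ := Int.eq_ofNat_of_zero_le (by omega : 0 ≤ e + 80)
  obtain rfl : e = u - 80 := by omega
  rw [hu] at hc
  exact ((((h0.sweep hL).sweep hL).sweep hL) u
    (List.all_eq_true.1 h u (List.mem_reverse.2 ((mem_codes_iff hdvd).2
      ⟨by omega, by exact_mod_cast hc, he⟩)))).2

set_option maxRecDepth 100000 in
theorem blockJoined_of_lt : (List.range 343).all blockJoined = true := by decide +kernel

theorem joined_of_small {D : ℕ} (h16 : 16 < D) (hle : D ≤ 5476)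
    (hmod : D % 8 = 0 ∨ D % 8 = 1 ∨ D % 8 = 4) (hexc : D ∉ exceptional) {e e' : ℤ}
    (he : e ∈ SD D) (he' : e' ∈ SD D) (h8 : D % 16 = 4 → e % 8 = e' % 8) :
    Relation.EqvGen (SMove D) e e' := by
  by_cases hu : D % 16 = 8 ∨ D % 16 = 12
  · obtain ⟨R, hR⟩ := exists_isRadius (D := D) (by omega)
    exact joined_of_unramified hR (by omega) he he'
  have hbound : ∀ x : ℤ, x ∈ SD D → -80 ≤ x ∧ x < 80 := fun x hx => by
    have := hx.2.1
    have : (D : ℤ) ≤ 5476 := by exact_mod_cast hle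
    constructor <;> nlinarith
  have hb := List.all_eq_true.1 blockJoined_of_lt (D / 16) (List.mem_range.2 (by omega))
  simp only [blockJoined, Bool.and_eq_true, Bool.or_eq_true, List.elem_iff] at hb
  have key : ∀ r c : ℕ, c ∣ 160 → sweepsJoinAll D r c = true → (r : ℤ) - 80 ∈ SD D →
      (e + 80) % c = r % c → (e' + 80) % c = r % c → Relation.EqvGen (SMove D) e e' :=
    fun r c hd h hr hc hc' =>
      ((joined_of_sweepsJoinAll hd h hr he (hbound e he).1 (hbound e he).2 hc).symm _ _).trans _ _ _
        (joined_of_sweepsJoinAll hd h hr he' (hbound e' he').1 (hbound e' he').2 hc')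
  obtain hD | hD | hD | hD : D = 16 * (D / 16) ∨ D = 16 * (D / 16) + 1 ∨ D = 16 * (D / 16) + 9 ∨
    D = 16 * (D / 16) + 4 := by omega
  · rw [← hD] at hb
    have h0 : (D : ℤ) % 8 = 0 := by omega
    have h4 := emod_four_eq_zero h0 he.1
    have h4' := emod_four_eq_zero h0 he'.1
    have hj := hb.1.1.1.resolve_left hexc
    clear hb hbound hmod he he' h8
    exact key 80 4 (by norm_num) hj ⟨by norm_num; omega, by norm_num; omega, by norm_num; omega⟩
      (by norm_num; omega) (by norm_num; omega)
  · rw [← hD] at hb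
    have h1 : (D : ℤ) % 8 = 1 := by omega
    have h2 := emod_two_eq_one h1 he.1
    have h2' := emod_two_eq_one h1 he'.1
    have hj := hb.1.1.2.resolve_left hexc
    clear hb hbound hmod he he' h8
    exact key 79 2 (by norm_num) hj ⟨by norm_num; omega, by norm_num; omega, by norm_num; omega⟩
      (by norm_num; omega) (by norm_num; omega)
  · rw [← hD] at hb
    have h1 : (D : ℤ) % 8 = 1 := by omega
    have h2 := emod_two_eq_one h1 he.1
    have h2' := emod_two_eq_one h1 he'.1
    have hj := hb.1.2.resolve_left hexc
    clear hb hbound hmod he he' h8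
    exact key 79 2 (by norm_num) hj ⟨by norm_num; omega, by norm_num; omega, by norm_num; omega⟩
      (by norm_num; omega) (by norm_num; omega)
  · rw [← hD] at hb
    have h36 : 36 < D := by
      by_contra h
      have : D = 20 ∨ D = 36 := by omega
      rcases this with rfl | rfl <;> simp [exceptional] at hexc
    have h4 := emod_four_eq_two (by omega) he.1
    have h8 := h8 (by omega)
    obtain ⟨hj, hj'⟩ := hb.2.resolve_left hexc
    clear hb hbound hmod he he'
    obtain h6 | h2 : e % 8 = 6 ∨ e % 8 = 2 := by omega
    · exact key 78 8 (by norm_num) hj ⟨by norm_num; omega, by norm_num; omega, by norm_num; omega⟩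
        (by norm_num; omega) (by norm_num; omega)
    · exact key 82 8 (by norm_num) hj' ⟨by norm_num; omega, by norm_num; omega, by norm_num; omega⟩
        (by norm_num; omega) (by norm_num; omega)

theorem SMove.emod_eight_eq {D e e' : ℤ} (hD : D % 16 = 4) (h : SMove D e e') :
    e % 8 = e' % 8 := by
  obtain ⟨he, -, q, -, rfl, hg⟩ := h
  have h4 := emod_four_eq_two (by omega) he.1
  have h16 := (sq_emod_sixteen e).2.1 h4
  clear he
  have hq : q % 2 = 1 := by
    by_contra hq
    have h2 : (2 : ℤ) ∣ Int.gcd q ((D - e ^ 2) / 8) := Int.dvd_coe_gcd (by omega) (by omega)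
    rw [hg] at h2
    norm_num at h2
  omega

theorem emod_eight_eq_of_joined {D e e' : ℤ} (hD : D % 16 = 4)
    (h : Relation.EqvGen (SMove D) e e') : e % 8 = e' % 8 := by
  induction h with
  | rel x y h => exact h.emod_eight_eq hD
  | refl x => rfl
  | symm x y _ ih => exact ih.symm
  | trans x y z _ _ ih1 ih2 => exact ih1.trans ih2

/-- For `D > 16`, `D ≡ 0,1,4 (mod 8)`, outside the exceptional list, `𝒮_D` is nonempty
and has exactly two components `{e ≡ 2 (mod 8)}`, `{e ≡ -2 (mod 8)}` when
`D ≡ 4 (mod 16)`, and exactly one component otherwise. -/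
theorem stmt4 (D : ℤ) (h16 : 16 < D) (hmod : D % 8 = 0 ∨ D % 8 = 1 ∨ D % 8 = 4)
    (hexc : D ∉ ({20, 36, 41, 73, 97, 112, 148, 196, 244, 292, 304, 436, 484, 676,
      1684} : Set ℤ)) :
    (SD D).Nonempty ∧
    (D % 16 = 4 →
      (∃ e ∈ SD D, e % 8 = 2) ∧ (∃ e ∈ SD D, e % 8 = 6) ∧
      (∀ e ∈ SD D, e % 8 = 2 ∨ e % 8 = 6) ∧
      (∀ e ∈ SD D, ∀ e' ∈ SD D,
        (Relation.EqvGen (SMove D) e e' ↔ e % 8 = e' % 8))) ∧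
    (D % 16 ≠ 4 →
      ∀ e ∈ SD D, ∀ e' ∈ SD D, Relation.EqvGen (SMove D) e e') := by
  have hjoin : ∀ e ∈ SD D, ∀ e' ∈ SD D, (D % 16 = 4 → e % 8 = e' % 8) →
      Relation.EqvGen (SMove D) e e' := by
    intro e he e' he' h8
    obtain ⟨R, hR⟩ := exists_isRadius (D := D) (by omega)
    by_cases h74 : 74 ≤ R
    · exact joined_of_large hR h74 hmod he he' h8
    · have hle : D ≤ 5476 := by nlinarith [hR.1, hR.2.2]
      lift D to ℕ using by omega
      refine joined_of_small (by omega) (by omega) (by omega) (fun h => hexc ?_) he he' (by omega)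
      simp only [exceptional, List.mem_cons, List.not_mem_nil, or_false] at h
      simp only [Set.mem_insert_iff, Set.mem_singleton_iff]
      omega
  have h36 : D % 16 = 4 → 36 < D := fun h => by
    simp only [Set.mem_insert_iff, Set.mem_singleton_iff] at hexc
    omega
  have hclass : D % 16 = 4 → ∀ e ∈ SD D, e % 8 = 2 ∨ e % 8 = 6 := fun hD e he => by
    have := emod_four_eq_two (by omega) he.1
    omega
  refine ⟨?_, fun hD => ⟨⟨2, ?_, by norm_num⟩, ⟨-2, ?_, by norm_num⟩, hclass hD,
    fun e he e' he' => ⟨fun h => ?_, fun h => hjoin e he e' he' fun _ => h⟩⟩,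
    fun hD e he e' he' => hjoin e he e' he' fun h => absurd h hD⟩
  · obtain h | h | h := hmod
    · exact ⟨-4, by norm_num; omega, by norm_num; omega, by norm_num; omega⟩
    · exact ⟨-1, by norm_num; omega, by norm_num; omega, by norm_num; omega⟩
    · exact ⟨-2, by norm_num; omega, by norm_num; omega, by norm_num; omega⟩
  · have := h36 hD
    exact ⟨by norm_num; omega, by norm_num; omega, by norm_num; omega⟩
  · exact ⟨by norm_num; omega, by norm_num; omega, by norm_num; omega⟩
  · exact emod_eight_eq_of_joined hD h
end

section
/- Let D be an integer with D > 6889 (= 83²), let e ∈ 𝒮_D, and set w = (D − e²)/8. Then there exists a positive integer q such that gcd(w, q) = 1, q ≢ 1 (mod 105), and 4q + 31 < √D. -/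
/-- A prime not congruent to `1` modulo `105`. -/
def AdmissiblePrime (n : ℕ) : Prop := n.Prime ∧ n % 105 ≠ 1

instance : DecidablePred AdmissiblePrime := fun n =>
  inferInstanceAs (Decidable (n.Prime ∧ n % 105 ≠ 1))

lemma setOfPred_admissiblePrime_infinite : (Set.ofPred AdmissiblePrime).Infinite := by
  refine (Nat.infinite_setOfPred_prime_and_eq_mod (q := 105) (a := 2)
    ((ZMod.isUnit_iff_coprime 2 105).2 (by norm_num))).mono ?_
  rintro p ⟨hp, h⟩
  refine ⟨hp, ?_⟩
  have h' : ((p : ℕ) : ZMod 105) = ((2 : ℕ) : ZMod 105) := by simpa using h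
  rw [ZMod.natCast_eq_natCast_iff'] at h'
  omega

/-- The increasing enumeration of the admissible primes, starting from index `0`. -/
noncomputable def admissible (i : ℕ) : ℕ := Nat.nth AdmissiblePrime i

lemma admissible_spec (i : ℕ) : AdmissiblePrime (admissible i) :=
  Nat.nth_mem_of_infinite setOfPred_admissiblePrime_infinite i

lemma admissible_prime (i : ℕ) : (admissible i).Prime := (admissible_spec i).1

lemma admissible_strictMono : StrictMono admissible :=
  Nat.nth_strictMono setOfPred_admissiblePrime_infinite

lemma exists_admissible_eq {n : ℕ} (h : AdmissiblePrime n) : ∃ i, admissible i = n :=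
  ⟨_, Nat.nth_count h⟩

lemma admissible_eq {n i : ℕ} (h : AdmissiblePrime n) (hi : Nat.count AdmissiblePrime n = i) :
    admissible i = n := hi ▸ Nat.nth_count h

lemma admissible_small : admissible 0 = 2 ∧ admissible 1 = 3 ∧ admissible 2 = 5 ∧
    admissible 3 = 7 ∧ admissible 4 = 11 ∧ admissible 5 = 13 ∧ admissible 6 = 17 ∧
    admissible 7 = 19 := by
  refine ⟨?_, ?_, ?_, ?_, ?_, ?_, ?_, ?_⟩ <;>
  · apply admissible_eq
    · exact ⟨by norm_num, by norm_num⟩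
    · norm_num [Nat.count_succ, AdmissiblePrime]

/-- The product of the first `k` admissible primes. -/
noncomputable def admissibleProd (k : ℕ) : ℕ := ∏ i ∈ Finset.range k, admissible i

lemma admissibleProd_succ (k : ℕ) :
    admissibleProd (k + 1) = admissibleProd k * admissible k :=
  Finset.prod_range_succ _ _

lemma admissibleProd_pos (k : ℕ) : 0 < admissibleProd k :=
  Finset.prod_pos fun i _ => (admissible_prime i).pos

lemma admissibleProd_mono : Monotone admissibleProd :=
  monotone_nat_of_le_succ fun k => by
    rw [admissibleProd_succ]
    exact Nat.le_mul_of_pos_right _ (admissible_prime k).pos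

lemma admissible_dvd_prod {t k : ℕ} (h : t < k) : admissible t ∣ admissibleProd k :=
  Finset.dvd_prod_of_mem _ (Finset.mem_range.2 h)

lemma admissible_coprime_prod {t k : ℕ} (h : k ≤ t) :
    (admissible t).Coprime (admissibleProd k) := by
  refine Nat.Coprime.prod_right fun i hi => ?_
  rw [Nat.coprime_primes (admissible_prime t) (admissible_prime i)]
  exact (admissible_strictMono (lt_of_lt_of_le (Finset.mem_range.1 hi) h)).ne'

lemma admissibleProd_dvd {k w : ℕ} (h : ∀ t < k, admissible t ∣ w) : admissibleProd k ∣ w := by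
  induction k with
  | zero => simp [admissibleProd]
  | succ k ih =>
    rw [admissibleProd_succ]
    exact (admissible_coprime_prod le_rfl).symm.mul_dvd_of_dvd_of_dvd
      (ih fun t ht => h t (by omega)) (h k (by omega))

lemma exists_prime_dvd_mod_three_ne_one (n : ℕ) (hn : n % 3 ≠ 1) :
    ∃ q, q.Prime ∧ q ∣ n ∧ q % 3 ≠ 1 := by
  induction n using Nat.recOnMul with
  | zero => exact ⟨2, Nat.prime_two, dvd_zero _, by norm_num⟩
  | one => simp at hn
  | prime p hp => exact ⟨p, hp, dvd_rfl, hn⟩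
  | mul a b iha ihb =>
    by_cases ha : a % 3 = 1
    · have hb : b % 3 ≠ 1 := fun hb => hn (by simp [Nat.mul_mod, ha, hb])
      obtain ⟨q, hq, hd, h⟩ := ihb hb
      exact ⟨q, hq, hd.mul_left _, h⟩
    · obtain ⟨q, hq, hd, h⟩ := iha ha
      exact ⟨q, hq, hd.mul_right _, h⟩

/-- The argument of Bonse, applied to the admissible primes. -/
lemma admissible_lt_prod {i k : ℕ} (hi : 2 ≤ i) (hk : k - i < admissible i) :
    admissible k < admissibleProd (i + 1) := by
  have hpos := admissibleProd_pos i
  obtain ⟨j, hj, hjt⟩ : ∃ j ∈ Finset.Icc 1 (admissible i),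
      ∀ t ∈ Finset.Ico i k, ¬ admissible t ∣ j * admissibleProd i - 1 := by
    by_contra! hcon
    choose! f hf hdvd using hcon
    obtain ⟨a, ha, b, hb, hab, hfab⟩ := Finset.exists_ne_map_eq_of_card_lt_of_maps_to
      (s := Finset.Icc 1 (admissible i)) (t := Finset.Ico i k) (f := f)
      (by simpa using hk) hf
    wlog hlt : a < b generalizing a b
    · exact this b hb a ha hab.symm hfab.symm (by omega)
    have h1 := hdvd a ha
    have h2 := hdvd b hb
    rw [← hfab] at h2
    have hle : i ≤ f a := (Finset.mem_Ico.1 (hf a ha)).1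
    have h3 := Nat.dvd_sub h2 h1
    rw [Finset.mem_Icc] at ha hb
    have h4 : 1 ≤ a * admissibleProd i := Nat.mul_pos ha.1 hpos
    have h5 : b * admissibleProd i - 1 - (a * admissibleProd i - 1)
        = (b - a) * admissibleProd i := by
      rw [Nat.sub_mul]; omega
    rw [h5] at h3
    have h6 := Nat.le_of_dvd (by omega) ((admissible_coprime_prod hle).dvd_of_dvd_mul_right h3)
    have h7 := admissible_strictMono.monotone hle
    omega
  rw [Finset.mem_Icc] at hj
  have hM : 1 ≤ j * admissibleProd i := Nat.mul_pos hj.1 hpos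
  have h3 : 3 ∣ j * admissibleProd i :=
    (admissible_small.2.1 ▸ admissible_dvd_prod (by omega : 1 < i)).mul_left j
  obtain ⟨q, hq, hqd, hq3⟩ := exists_prime_dvd_mod_three_ne_one (j * admissibleProd i - 1)
    (by omega)
  obtain ⟨t, rfl⟩ := exists_admissible_eq (n := q) ⟨hq, by omega⟩
  have hti : i ≤ t := by
    by_contra! hlt
    have h1 := Nat.dvd_sub ((admissible_dvd_prod hlt).mul_left j) hqd
    rw [Nat.sub_sub_self hM] at h1
    exact hq.one_lt.ne' (Nat.dvd_one.1 h1)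
  have htk : k ≤ t := by
    by_contra! hlt
    exact hjt t (Finset.mem_Ico.2 ⟨hti, hlt⟩) hqd
  have h1 := Nat.le_of_dvd (by omega) hqd
  have h2 := admissible_strictMono.monotone htk
  have h4 : j * admissibleProd i ≤ admissibleProd (i + 1) := by
    rw [admissibleProd_succ, mul_comm]
    exact Nat.mul_le_mul_left _ hj.2
  omega

lemma add_four_le_admissible {i : ℕ} (hi : 3 ≤ i) : i + 4 ≤ admissible i := by
  induction i, hi using Nat.le_induction with
  | base => simp [admissible_small]
  | succ n _ ih =>
    have := admissible_strictMono (Nat.lt_succ_self n)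
    simp only [Nat.succ_eq_add_one] at this
    omega

lemma five_mul_prod_sq_le {n : ℕ} (hn : 4 ≤ n) :
    5 * admissibleProd n ^ 2 ≤ admissibleProd (2 * n) := by
  obtain ⟨m, rfl⟩ : ∃ m, n = m + 1 := ⟨n - 1, by omega⟩
  have h0 : 10 ≤ admissible (m + 1) := by
    have := admissible_strictMono.monotone hn
    rw [admissible_small.2.2.2.2.1] at this
    omega
  have hsplit : admissibleProd (2 * (m + 1)) = admissibleProd (m + 1) *
      ∏ t ∈ Finset.range (m + 1), admissible (m + 1 + t) := by
    rw [two_mul]; exact Finset.prod_range_add _ _ _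
  have hprod : 5 * admissibleProd (m + 1) ≤
      ∏ t ∈ Finset.range (m + 1), admissible (m + 1 + t) := by
    rw [admissibleProd, Finset.prod_range_succ', Finset.prod_range_succ', admissible_small.1,
      mul_left_comm]
    refine Nat.mul_le_mul (Finset.prod_le_prod' fun t _ => ?_) h0
    exact admissible_strictMono.monotone (by omega)
  rw [hsplit, pow_two, mul_left_comm]
  exact Nat.mul_le_mul_left _ hprod

lemma admissibleProd_six : admissibleProd 6 = 30030 := by
  simp [admissibleProd, Finset.prod_range_succ, admissible_small]

lemma admissible_sq_lt {k : ℕ} (hk : 6 ≤ k) :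
    (4 * admissible k + 31) ^ 2 < 8 * admissibleProd k := by
  obtain hk8 | hk8 := lt_or_ge k 8
  · have h := admissibleProd_mono hk
    rw [admissibleProd_six] at h
    have h19 : admissible k ≤ 19 := by
      rw [← admissible_small.2.2.2.2.2.2.2]
      exact admissible_strictMono.monotone (by omega)
    nlinarith
  · obtain ⟨i, hi3, hik, hki⟩ : ∃ i, 3 ≤ i ∧ 2 * (i + 1) ≤ k ∧ k - i < i + 4 :=
      ⟨(k - 2) / 2, by omega, by omega, by omega⟩
    have h1 := admissible_lt_prod (by omega : 2 ≤ i)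
      (hki.trans_le (add_four_le_admissible hi3))
    have h2 := five_mul_prod_sq_le (by omega : 4 ≤ i + 1)
    have h3 := admissibleProd_mono hik
    have h4 : 210 ≤ admissibleProd (i + 1) := by
      have h := admissibleProd_mono (by omega : 4 ≤ i + 1)
      have h' : admissibleProd 4 = 210 := by
        simp [admissibleProd, Finset.prod_range_succ, admissible_small]
      omega
    nlinarith

/-- For `D > 83² = 6889` and `e ∈ 𝒮_D`, with `w = (D - e²)/8`, there is a positive
integer `q` with `gcd(w,q) = 1`, `q ≢ 1 (mod 105)` and `4q + 31 < √D`. -/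
theorem stmt9 (D : ℤ) (hD : 6889 < D) (e : ℤ) (he : e ∈ SD D) :
    ∃ q : ℤ, 0 < q ∧ Int.gcd ((D - e ^ 2) / 8) q = 1 ∧ q % 105 ≠ 1 ∧
      ((4 * q + 31 : ℤ) : ℝ) < Real.sqrt (D : ℝ) := by
  obtain ⟨hmod, hlt, -⟩ := he
  obtain ⟨w, hw⟩ := Int.eq_ofNat_of_zero_le (by omega : 0 ≤ (D - e ^ 2) / 8)
  have hwpos : 0 < w := by omega
  have hwD : 8 * (w : ℤ) ≤ D := by
    have := sq_nonneg e
    omega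
  have hex : ∃ k, ¬ admissible k ∣ w := by
    refine ⟨w + 1, fun h => ?_⟩
    have h1 := Nat.le_of_dvd hwpos h
    have h2 := admissible_strictMono.le_apply (x := w + 1)
    omega
  classical
  set k := Nat.find hex
  have hk : ¬ admissible k ∣ w := Nat.find_spec hex
  have hmin : ∀ t < k, admissible t ∣ w := fun t ht => not_not.1 (Nat.find_min hex ht)
  have hPw : admissibleProd k ≤ w := Nat.le_of_dvd hwpos (admissibleProd_dvd hmin)
  refine ⟨admissible k, by exact_mod_cast (admissible_prime k).pos, ?_, ?_, ?_⟩
  · rw [hw]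
    exact (((admissible_prime k).coprime_iff_not_dvd).2 hk).symm
  · have := (admissible_spec k).2
    omega
  · apply Real.lt_sqrt_of_sq_lt
    suffices h : (4 * (admissible k : ℤ) + 31) ^ 2 < D by exact_mod_cast h
    obtain h6 | h6 := lt_or_ge k 6
    · have h13 : admissible k ≤ 13 := by
        rw [← admissible_small.2.2.2.2.2.1]
        exact admissible_strictMono.monotone (by omega)
      have : (admissible k : ℤ) ≤ 13 := by exact_mod_cast h13
      nlinarith
    · have h : (4 * (admissible k : ℤ) + 31) ^ 2 < 8 * admissibleProd k := by
        exact_mod_cast admissible_sq_lt h6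
      omega
end

section
/- Let D > 16 be an even integer with D ≡ 0 or 4 (mod 8). If D ∉ {48, 68, 100}, then 𝒬_D has exactly one component. -/
/-- gcd of four integers. -/
def gcd4 (a b c d : ℤ) : ℕ := Int.gcd a (Int.gcd b (Int.gcd c d : ℤ) : ℤ)

/-- The prototype set `𝒫_D`: quadruples `(w,h,t,e)` with `w > 0`, `h > 0`,
`0 ≤ t < gcd(w,h)`, `e + 2h < w`, `gcd(w,h,t,e) = 1` and `D = e² + 8wh`. -/
def IsProto (D : ℤ) (p : ℤ × ℤ × ℤ × ℤ) : Prop :=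
  0 < p.1 ∧ 0 < p.2.1 ∧ 0 ≤ p.2.2.1 ∧ p.2.2.1 < (Int.gcd p.1 p.2.1 : ℤ) ∧
  p.2.2.2 + 2 * p.2.1 < p.1 ∧ gcd4 p.1 p.2.1 p.2.2.1 p.2.2.2 = 1 ∧
  D = p.2.2.2 ^ 2 + 8 * p.1 * p.2.1

/-- The Butterfly move `B_q` (for a positive integer `q`) relates `(w,h,t,e)` to
`(w',h',t',e')` whenever `(e+4qh)² < D`, `e' = -e-4qh` and `h' = gcd(qh, w+qt)`. -/
def BMove (D q : ℤ) (p p' : ℤ × ℤ × ℤ × ℤ) : Prop :=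
  (p.2.2.2 + 4 * q * p.2.1) ^ 2 < D ∧
  p'.2.2.2 = -p.2.2.2 - 4 * q * p.2.1 ∧
  p'.2.1 = (Int.gcd (q * p.2.1) (p.1 + q * p.2.2.1) : ℤ)

/-- The Butterfly move `B_∞` relates `(w,h,t,e)` to `(w',h',t',e')` whenever
`e' = -e-4h` and `h' = gcd(t,h)`. -/
def BMoveInf (p p' : ℤ × ℤ × ℤ × ℤ) : Prop :=
  p'.2.2.2 = -p.2.2.2 - 4 * p.2.1 ∧ p'.2.1 = (Int.gcd p.2.2.1 p.2.1 : ℤ)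

/-- Two prototypes of `𝒫_D` are related when some Butterfly move
`B_q`, `q ∈ {1,2,3,…} ∪ {∞}`, takes one to the other. -/
def Butterfly (D : ℤ) (p p' : ℤ × ℤ × ℤ × ℤ) : Prop :=
  IsProto D p ∧ IsProto D p' ∧ ((∃ q : ℤ, 0 < q ∧ BMove D q p p') ∨ BMoveInf p p')

/-- Membership in `𝒬_D = 𝒫_D × {+1, -1}`. -/
def IsProtoQ (D : ℤ) (x : (ℤ × ℤ × ℤ × ℤ) × ℤ) : Prop :=
  IsProto D x.1 ∧ (x.2 = 1 ∨ x.2 = -1)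

/-- The generating relation on `𝒬_D`: `(p, ε)` is related to `(p', -ε)` whenever `p` is
related to `p'` by a Butterfly move. -/
def QMove (D : ℤ) (x y : (ℤ × ℤ × ℤ × ℤ) × ℤ) : Prop :=
  Butterfly D x.1 y.1 ∧ y.2 = -x.2

/-- Two elements of `𝒬_D` lie in the same component. -/
def Conn (D : ℤ) : (ℤ × ℤ × ℤ × ℤ) × ℤ → (ℤ × ℤ × ℤ × ℤ) × ℤ → Prop :=
  Relation.EqvGen (QMove D)

/-- The integers `e` for which `(w, 1, 0, e)` is a prototype for some `w`. -/
def IsReducedParam (D e : ℤ) : Prop :=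
  e ^ 2 < D ∧ (e + 4) ^ 2 < D ∧ (8 : ℤ) ∣ D - e ^ 2

/-- The reduced prototype with parameter `e`. -/
def reducedProto (D e : ℤ) : ℤ × ℤ × ℤ × ℤ := ((D - e ^ 2) / 8, 1, 0, e)

lemma Conn.refl {D : ℤ} (x) : Conn D x x := Relation.EqvGen.refl x

lemma Conn.symm {D : ℤ} {x y} (h : Conn D x y) : Conn D y x := Relation.EqvGen.symm _ _ h

lemma Conn.trans {D : ℤ} {x y z} (h : Conn D x y) (h' : Conn D y z) : Conn D x z :=
  Relation.EqvGen.trans _ _ _ h h'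

lemma conn_of_butterfly {D : ℤ} {p p'} (h : Butterfly D p p') (ε : ℤ) :
    Conn D (p, ε) (p', -ε) :=
  Relation.EqvGen.rel _ _ ⟨h, rfl⟩

lemma gcd4_eq_one_of_gcd_eq_one {w h t e : ℤ} (H : Int.gcd w h = 1) : gcd4 w h t e = 1 := by
  unfold gcd4
  rw [← Int.gcd_assoc, H]
  simp

lemma gcd4_one_third (w h e : ℤ) : gcd4 w h 1 e = 1 := by
  simp [gcd4]

lemma isProto_mk {D w h t e : ℤ} (hh : 0 < h) (hD : D = e ^ 2 + 8 * w * h) (h1 : e ^ 2 < D)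
    (h2 : (e + 4 * h) ^ 2 < D) (ht : 0 ≤ t) (ht' : t < Int.gcd w h)
    (hg : gcd4 w h t e = 1) : IsProto D (w, h, t, e) := by
  have hw : 0 < w := by
    by_contra hw
    push Not at hw
    nlinarith [mul_nonneg (neg_nonneg.2 hw) hh.le]
  refine ⟨hw, hh, ht, ht', ?_, hg, hD⟩
  have : 0 < h * (w - (e + 2 * h)) := by nlinarith
  have := pos_of_mul_pos_right this hh.le
  simp only
  linarith

lemma IsProto.sq_lt {D w h t e : ℤ} (H : IsProto D (w, h, t, e)) : e ^ 2 < D := by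
  obtain ⟨hw, hh, -, -, -, -, hD⟩ := H
  simp only at *
  have := mul_pos hw hh
  linarith

lemma IsProto.add_sq_lt {D w h t e : ℤ} (H : IsProto D (w, h, t, e)) :
    (e + 4 * h) ^ 2 < D := by
  obtain ⟨hw, hh, -, -, he, -, hD⟩ := H
  simp only at *
  nlinarith [mul_pos hh (sub_pos.2 he)]

lemma isProto_zero {D w h e : ℤ} (hh : 0 < h) (hD : D = e ^ 2 + 8 * w * h) (h1 : e ^ 2 < D)
    (h2 : (e + 4 * h) ^ 2 < D) (hg : Int.gcd w h = 1) : IsProto D (w, h, 0, e) :=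
  isProto_mk hh hD h1 h2 le_rfl (by simp [hg]) (gcd4_eq_one_of_gcd_eq_one hg)

lemma isProto_one {D w h e : ℤ} (hh : 0 < h) (hD : D = e ^ 2 + 8 * w * h) (h1 : e ^ 2 < D)
    (h2 : (e + 4 * h) ^ 2 < D) (hg : Int.gcd w h ≠ 1) : IsProto D (w, h, 1, e) := by
  refine isProto_mk hh hD h1 h2 zero_le_one ?_ (gcd4_one_third _ _ _)
  have : 0 < Int.gcd w h := Int.gcd_pos_of_ne_zero_right _ hh.ne'
  omega

lemma exists_isProto {D w h e : ℤ} (hh : 0 < h) (hD : D = e ^ 2 + 8 * w * h) (h1 : e ^ 2 < D)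
    (h2 : (e + 4 * h) ^ 2 < D) : ∃ t, IsProto D (w, h, t, e) := by
  by_cases hg : Int.gcd w h = 1
  · exact ⟨0, isProto_zero hh hD h1 h2 hg⟩
  · exact ⟨1, isProto_one hh hD h1 h2 hg⟩

lemma IsReducedParam.eq_add {D e : ℤ} (H : IsReducedParam D e) :
    D = e ^ 2 + 8 * ((D - e ^ 2) / 8) := by
  have := Int.mul_ediv_cancel' H.2.2
  omega

lemma isProto_reducedProto {D e : ℤ} (H : IsReducedParam D e) : IsProto D (reducedProto D e) :=
  isProto_zero one_pos (by have := H.eq_add; linarith) H.1 (by simpa using H.2.1) (by simp)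

lemma IsProto.isReducedParam {D w t e : ℤ} (H : IsProto D (w, 1, t, e)) :
    IsReducedParam D e ∧ (w, 1, t, e) = reducedProto D e := by
  have h1 := H.sq_lt
  have h2 := H.add_sq_lt
  obtain ⟨-, -, ht, ht', -, -, hD⟩ := H
  simp only [Int.gcd_one_right, Nat.cast_one, mul_one] at *
  have h8 : D - e ^ 2 = 8 * w := by linarith
  refine ⟨⟨h1, h2, w, h8⟩, ?_⟩
  have : t = 0 := by omega
  rw [reducedProto, h8, this, Int.mul_ediv_cancel_left _ (by norm_num)]

/-- A Butterfly move changing `e` to `-e - 4qh` has an integral new value of `w`. -/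
lemma sq_add_of_move {D w h e q h' : ℤ} (hD : D = e ^ 2 + 8 * w * h) (h1 : h' ∣ q * h)
    (h2 : h' ∣ w * h) :
    ∃ w', D = (-e - 4 * q * h) ^ 2 + 8 * w' * h' := by
  obtain ⟨a, ha⟩ := h1
  obtain ⟨b, hb⟩ := h2
  refine ⟨b - a * e - 2 * q * h * a, ?_⟩
  linear_combination hD + 8 * hb - 8 * (e + 2 * q * h) * ha

lemma sq_lt_of_between {D a b c : ℤ} (h1 : a ^ 2 < D) (h2 : b ^ 2 < D) (h3 : a ≤ c)
    (h4 : c ≤ b) : c ^ 2 < D := by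
  rcases le_total 0 c with h | h <;> nlinarith

/-- `B_∞` leads to any prototype with the right `h` and `e`. -/
lemma conn_inf {D w h t e w' t' : ℤ} {h' e' : ℤ} (H : IsProto D (w, h, t, e))
    (H' : IsProto D (w', h', t', e')) (he : e' = -e - 4 * h) (hh : h' = (Int.gcd t h : ℤ))
    (ε : ℤ) : Conn D ((w, h, t, e), ε) ((w', h', t', e'), -ε) :=
  conn_of_butterfly ⟨H, H', Or.inr ⟨he, hh⟩⟩ ε

/-- `B_q` leads to any prototype with the right `h` and `e`. -/
lemma conn_q {D w h t e w' t' : ℤ} {h' e' : ℤ} (q : ℤ) (H : IsProto D (w, h, t, e))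
    (H' : IsProto D (w', h', t', e')) (hq : 0 < q) (he : e' = -e - 4 * q * h)
    (hh : h' = (Int.gcd (q * h) (w + q * t) : ℤ)) (ε : ℤ) :
    Conn D ((w, h, t, e), ε) ((w', h', t', e'), -ε) := by
  refine conn_of_butterfly ⟨H, H', Or.inl ⟨q, hq, ?_, he, hh⟩⟩ ε
  have := H'.sq_lt
  rw [he] at this
  simp only
  linarith [neg_sq (e + 4 * q * h), show (-e - 4 * q * h) ^ 2 = (e + 4 * q * h) ^ 2 by ring]

lemma exists_conn_inf {D w h t e : ℤ} (H : IsProto D (w, h, t, e)) (ε : ℤ) :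
    ∃ w' t', IsProto D (w', (Int.gcd t h : ℤ), t', -e - 4 * h) ∧
      Conn D ((w, h, t, e), ε) ((w', (Int.gcd t h : ℤ), t', -e - 4 * h), -ε) := by
  have hh : 0 < h := H.2.1
  have hg : (0 : ℤ) < Int.gcd t h := by exact_mod_cast Int.gcd_pos_of_ne_zero_right _ hh.ne'
  have hle : (Int.gcd t h : ℤ) ≤ h := Int.le_of_dvd hh (Int.gcd_dvd_right _ _)
  obtain ⟨w', hw'⟩ := sq_add_of_move (q := 1) (h' := Int.gcd t h) H.2.2.2.2.2.2
    (by simpa using Int.gcd_dvd_right t h) ((Int.gcd_dvd_right t h).mul_left w)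
  simp only [mul_one] at hw'
  obtain ⟨t', ht'⟩ := exists_isProto hg hw'
    (by have := H.add_sq_lt; linarith [show (-e - 4 * h) ^ 2 = (e + 4 * h) ^ 2 by ring])
    (sq_lt_of_between (a := -e - 4 * h) (b := -e)
      (by have := H.add_sq_lt; linarith [show (-e - 4 * h) ^ 2 = (e + 4 * h) ^ 2 by ring])
      (by rw [neg_sq]; exact H.sq_lt) (by linarith) (by linarith))
  exact ⟨w', t', ht', conn_inf H ht' rfl rfl ε⟩

lemma exists_conn_q {D w h t e : ℤ} (q : ℤ) (hq : 0 < q) (H : IsProto D (w, h, t, e))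
    (hlt : (e + 4 * q * h) ^ 2 < D) (ε : ℤ) :
    ∃ w' t', IsProto D (w', (Int.gcd (q * h) (w + q * t) : ℤ), t', -e - 4 * q * h) ∧
      Conn D ((w, h, t, e), ε)
        ((w', (Int.gcd (q * h) (w + q * t) : ℤ), t', -e - 4 * q * h), -ε) := by
  have hh : 0 < h := H.2.1
  have hqh : 0 < q * h := mul_pos hq hh
  set g : ℤ := (Int.gcd (q * h) (w + q * t) : ℤ) with hgdef
  have hg : 0 < g := Int.natCast_pos.2 (Int.gcd_pos_of_ne_zero_left _ hqh.ne')
  have hd1 : g ∣ q * h := Int.gcd_dvd_left _ _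
  have hd2 : g ∣ w + q * t := Int.gcd_dvd_right _ _
  have hle : g ≤ q * h := Int.le_of_dvd hqh hd1
  have hneg : (-e - 4 * q * h) ^ 2 < D := by
    linarith [show (-e - 4 * q * h) ^ 2 = (e + 4 * q * h) ^ 2 by ring]
  obtain ⟨w', hw'⟩ := sq_add_of_move (q := q) (h' := g) H.2.2.2.2.2.2 hd1
    (by
      have : w * h = (w + q * t) * h - q * h * t := by ring
      show g ∣ w * h
      rw [this]
      exact dvd_sub (hd2.mul_right h) (hd1.mul_right t))
  obtain ⟨t', ht'⟩ := exists_isProto hg hw' hneg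
    (sq_lt_of_between (a := -e - 4 * q * h) (b := -e) hneg (by rw [neg_sq]; exact H.sq_lt)
      (by linarith) (by linarith))
  exact ⟨w', t', ht', conn_q q H ht' hq rfl hgdef ε⟩

/-- Every prototype is connected to a reduced one. -/
lemma exists_conn_reducedProto {D : ℤ} (n : ℕ) : ∀ w h t e ε : ℤ, h ≤ n →
    IsProto D (w, h, t, e) →
    ∃ e', IsReducedParam D e' ∧ (Conn D ((w, h, t, e), ε) (reducedProto D e', ε) ∨
      Conn D ((w, h, t, e), ε) (reducedProto D e', -ε)) := by
  induction n with
  | zero => intro w h t e ε hn H; exact absurd H.2.1 (by simpa using hn)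
  | succ n ih =>
    intro w h t e ε hn H
    have hh : 0 < h := H.2.1
    have step : ∀ w' h' t' e' ε', (ε' = ε ∨ ε' = -ε) → h' < h → IsProto D (w', h', t', e') →
        Conn D ((w, h, t, e), ε) ((w', h', t', e'), ε') →
        ∃ e', IsReducedParam D e' ∧ (Conn D ((w, h, t, e), ε) (reducedProto D e', ε) ∨
          Conn D ((w, h, t, e), ε) (reducedProto D e', -ε)) := by
      intro w' h' t' e' ε' hε hlt H' hc
      obtain ⟨e₁, he₁, hc₁⟩ := ih w' h' t' e' ε' (by push_cast at hn; linarith) H'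
      refine ⟨e₁, he₁, ?_⟩
      rcases hε with rfl | rfl
      · exact hc₁.imp hc.trans hc.trans
      · rw [neg_neg] at hc₁
        exact hc₁.symm.imp hc.trans hc.trans
    by_cases h1 : h = 1
    · subst h1
      obtain ⟨h2, h3⟩ := H.isReducedParam
      exact ⟨e, h2, Or.inl (h3 ▸ Conn.refl _)⟩
    have ht0 : 0 ≤ t := H.2.2.1
    have htg : t < (Int.gcd w h : ℤ) := H.2.2.2.1
    have hgh : (Int.gcd w h : ℤ) ≤ h := Int.le_of_dvd hh (Int.gcd_dvd_right _ _)
    rcases ht0.eq_or_lt with rfl | ht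
    · by_cases hw : h ∣ w
      · have hw' : (Int.gcd w h : ℤ) = h := Int.gcd_eq_right hh.le hw
        have he : Int.gcd e h = 1 := by
          have := H.2.2.2.2.2.1
          simp only [gcd4, Int.gcd_zero_left] at this
          rw [← Int.gcd_assoc, hw'] at this
          rw [Int.gcd_comm]
          simpa [Int.gcd, Int.natAbs_abs] using this
        obtain ⟨w₁, t₁, H₁, hc₁⟩ := exists_conn_inf H ε
        have hgh' : (Int.gcd 0 h : ℤ) = h := by simp [hh.le]
        rw [hgh'] at H₁ hc₁
        have hw₁ : w₁ = w - e - 2 * h := by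
          have h1 : D = e ^ 2 + 8 * w * h := H.2.2.2.2.2.2
          have h2 : D = (-e - 4 * h) ^ 2 + 8 * w₁ * h := H₁.2.2.2.2.2.2
          have : h * w₁ = h * (w - e - 2 * h) := by linarith
          exact mul_left_cancel₀ hh.ne' this
        have hco : IsCoprime w₁ h := by
          obtain ⟨k, rfl⟩ := hw
          have : w₁ = -e + h * (k - 2) := by rw [hw₁]; ring
          rw [this]
          exact (Int.isCoprime_iff_gcd_eq_one.2 he).neg_left.add_mul_left_left _
        have hco' := Int.isCoprime_iff_gcd_eq_one.1 hco
        have ht₁ : t₁ = 0 := by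
          have h1 : 0 ≤ t₁ := H₁.2.2.1
          have h2 : t₁ < (Int.gcd w₁ h : ℤ) := H₁.2.2.2.1
          rw [hco'] at h2
          push_cast at h2
          omega
        subst ht₁
        obtain ⟨w₂, t₂, H₂, hc₂⟩ :=
          exists_conn_q 1 one_pos H₁ (by simpa using H₁.add_sq_lt) (-ε)
        simp only [one_mul, mul_zero, add_zero, neg_neg, Int.gcd_comm h, hco'] at H₂ hc₂
        exact step _ _ _ _ _ (Or.inl rfl) (lt_of_le_of_ne hh (Ne.symm h1)) H₂
          (hc₁.trans hc₂)
      · obtain ⟨w₁, t₁, H₁, hc₁⟩ := exists_conn_q 1 one_pos H (by simpa using H.add_sq_lt) ε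
        refine step _ _ _ _ _ (Or.inr rfl) ?_ H₁ hc₁
        simp only [one_mul, mul_zero, add_zero]
        refine lt_of_le_of_ne (Int.le_of_dvd hh (Int.gcd_dvd_left _ _)) fun hc => hw ?_
        rw [← hc]
        exact Int.gcd_dvd_right _ _
    · obtain ⟨w₁, t₁, H₁, hc₁⟩ := exists_conn_inf H ε
      refine step _ _ _ _ _ (Or.inr rfl) ?_ H₁ hc₁
      exact lt_of_le_of_lt (Int.le_of_dvd ht (Int.gcd_dvd_left _ _)) (htg.trans_le hgh)

/-- The reduced prototypes with parameters `e` and `e'` are connected, with equal signs. -/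
def SameConn (D e e' : ℤ) : Prop :=
  ∀ ε, Conn D (reducedProto D e, ε) (reducedProto D e', ε)

/-- The reduced prototypes with parameters `e` and `e'` are connected, with opposite signs. -/
def FlipConn (D e e' : ℤ) : Prop :=
  ∀ ε, Conn D (reducedProto D e, ε) (reducedProto D e', -ε)

/-- The reduced prototypes with parameters `e` and `e'` are connected, up to sign. -/
def WeakConn (D e e' : ℤ) : Prop := SameConn D e e' ∨ FlipConn D e e'

lemma SameConn.symm {D e e' : ℤ} (h : SameConn D e e') : SameConn D e' e := fun ε => (h ε).symm

lemma SameConn.trans {D a b c : ℤ} (h : SameConn D a b) (h' : SameConn D b c) :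
    SameConn D a c := fun ε => (h ε).trans (h' ε)

lemma FlipConn.symm {D e e' : ℤ} (h : FlipConn D e e') : FlipConn D e' e := fun ε => by
  simpa using (h (-ε)).symm

lemma SameConn.trans_flip {D a b c : ℤ} (h : SameConn D a b) (h' : FlipConn D b c) :
    FlipConn D a c := fun ε => (h ε).trans (h' ε)

lemma FlipConn.trans_same {D a b c : ℤ} (h : FlipConn D a b) (h' : SameConn D b c) :
    FlipConn D a c := fun ε => (h ε).trans (h' (-ε))

lemma FlipConn.trans {D a b c : ℤ} (h : FlipConn D a b) (h' : FlipConn D b c) :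
    SameConn D a c := fun ε => by simpa using (h ε).trans (h' (-ε))

lemma WeakConn.trans {D a b c : ℤ} (h : WeakConn D a b) (h' : WeakConn D b c) :
    WeakConn D a c := by
  rcases h with h | h <;> rcases h' with h' | h'
  exacts [Or.inl (h.trans h'), Or.inr (h.trans_flip h'), Or.inr (h.trans_same h'),
    Or.inl (h.trans h')]

lemma WeakConn.refl (D e : ℤ) : WeakConn D e e := Or.inl fun _ => Conn.refl _

lemma IsReducedParam.neg_sub {D e : ℤ} (H : IsReducedParam D e) :
    IsReducedParam D (-e - 4) := by
  obtain ⟨h1, h2, h3⟩ := H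
  refine ⟨by linarith [show (-e - 4) ^ 2 = (e + 4) ^ 2 by ring],
    by linarith [show (-e - 4 + 4) ^ 2 = e ^ 2 by ring], ?_⟩
  by_cases he : (2 : ℤ) ∣ e
  · obtain ⟨k, rfl⟩ := he
    have : D - (-(2 * k) - 4) ^ 2 = (D - (2 * k) ^ 2) - 8 * (2 * k + 2) := by ring
    rw [this]
    exact dvd_sub h3 (dvd_mul_right _ _)
  · have : D - (-e - 4) ^ 2 = (D - e ^ 2) - 8 * (e + 2) := by ring
    rw [this]
    exact dvd_sub h3 (dvd_mul_right _ _)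

lemma conn_reducedProto_one {D e : ℤ} (H : IsReducedParam D e) :
    FlipConn D e (-e - 4) := fun ε => by
  have H' := isProto_reducedProto H.neg_sub
  exact conn_q 1 (isProto_reducedProto H) H' one_pos (by ring) (by simp) ε

lemma IsReducedParam.of_between {D a b e k : ℤ} (ha : IsReducedParam D a)
    (hb : b ^ 2 < D) (h1 : a ≤ e) (h2 : e + 4 ≤ b) (he : e = a + 4 * k) :
    IsReducedParam D e := by
  refine ⟨sq_lt_of_between ha.1 hb h1 (by linarith),
    sq_lt_of_between ha.1 hb (by linarith) h2, ?_⟩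
  have : D - e ^ 2 = (D - a ^ 2) - 8 * (a * k + 2 * k ^ 2) := by rw [he]; ring
  rw [this]
  exact dvd_sub ha.2.2 (dvd_mul_right _ _)

/-- Applying `B_q` to a reduced prototype and then returning to a reduced prototype. -/
lemma sameConn_add {D e q g : ℤ} (H : IsReducedParam D e) (hq : 0 < q)
    (hlt : (e + 4 * q) ^ 2 < D) (hg : g = Int.gcd q ((D - e ^ 2) / 8)) :
    IsReducedParam D (e + 4 * (q - g)) ∧ SameConn D e (e + 4 * (q - g)) := by
  have hg0 : 0 < g := hg ▸ Int.natCast_pos.2 (Int.gcd_pos_of_ne_zero_left _ hq.ne')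
  have hgq : g ≤ q := hg ▸ Int.le_of_dvd hq (Int.gcd_dvd_left _ _)
  have H₂ : IsReducedParam D (e + 4 * (q - g)) :=
    H.of_between hlt (by linarith) (by linarith) rfl
  refine ⟨H₂, fun ε => ?_⟩
  have P := isProto_reducedProto H
  have P₂ := isProto_reducedProto H₂
  obtain ⟨w', t', P₁, -⟩ := exists_conn_q q hq P (by simpa using hlt) ε
  simp only [mul_one, mul_zero, add_zero, ← hg] at P₁
  obtain ⟨-, -, -, -, -, -, hD⟩ := id P₁
  by_cases hc : Int.gcd w' g = 1
  · have Q := isProto_zero hg0 hD P₁.sq_lt P₁.add_sq_lt hc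
    have c₁ := conn_q q P Q hq (by ring) (by simpa using hg) ε
    have c₂ := conn_q 1 Q P₂ one_pos (by ring) (by simp [Int.gcd_comm g, hc]) (-ε)
    rw [neg_neg] at c₂
    exact c₁.trans c₂
  · have Q := isProto_one hg0 hD P₁.sq_lt P₁.add_sq_lt hc
    have c₁ := conn_q q P Q hq (by ring) (by simpa using hg) ε
    have c₂ := conn_inf Q P₂ (by ring) (by simp) (-ε)
    rw [neg_neg] at c₂
    exact c₁.trans c₂

/-- The word `B_2 B_3` subtracts `16` from `e`, under suitable congruence conditions. -/
lemma sameConn_sub {D e : ℤ} (H : IsReducedParam D e) (he : (2 : ℤ) ∣ e)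
    (hlt : (e + 8) ^ 2 < D) (H₂ : IsReducedParam D (e - 16))
    (h4 : (32 : ℤ) ∣ D - e ^ 2) (h3 : ¬ (3 : ℤ) ∣ (D - e ^ 2) / 16 - e - 4) :
    SameConn D e (e - 16) := fun ε => by
  have P := isProto_reducedProto H
  have P₂ := isProto_reducedProto H₂
  obtain ⟨c, rfl⟩ := he
  obtain ⟨k, hk⟩ := h4
  have hw : (D - (2 * c) ^ 2) / 8 = 4 * k := by omega
  have hw' : (D - (2 * c) ^ 2) / 16 = 2 * k := by omega
  rw [hw'] at h3
  have Q : IsProto D (2 * k - 2 * c - 4, 2, 1, -(2 * c) - 8) := by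
    refine isProto_one two_pos (by linarith) ?_ ?_ ?_
    · linarith [show (-(2 * c) - 8) ^ 2 = (2 * c + 8) ^ 2 by ring]
    · linarith [show (-(2 * c) - 8 + 4 * 2) ^ 2 = (2 * c) ^ 2 by ring, H.1]
    · intro h
      have : (2 : ℤ) ∣ (Int.gcd (2 * k - 2 * c - 4) 2 : ℤ) :=
        Int.dvd_coe_gcd ⟨k - c - 2, by ring⟩ dvd_rfl
      rw [h] at this
      norm_num at this
  have c₁ := conn_q 2 P Q two_pos (by ring)
    (by simp only [mul_one, mul_zero, add_zero]; rw [hw, Int.gcd_eq_left] <;> omega) ε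
  have c₂ := conn_q 3 Q P₂ three_pos (by ring) (by
    have : IsCoprime (3 * 2 : ℤ) (2 * k - 2 * c - 4 + 3 * 1) := by
      refine IsCoprime.mul_left ?_ ⟨-(k - c - 1), 1, by ring⟩
      have : IsCoprime (3 : ℤ) (2 * k - 2 * c - 4) :=
        (Int.prime_three.coprime_iff_not_dvd).2 h3
      exact this.add_mul_left_right 1
    rw [Int.isCoprime_iff_gcd_eq_one.1 this, Nat.cast_one]) (-ε)
  rw [neg_neg] at c₂
  exact c₁.trans c₂

lemma weakConn_lower {D e q g : ℤ} (H : IsReducedParam D e) (hlt : 2 * q ≤ e + 4)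
    (hg : g = Int.gcd q ((D - (e + 4) ^ 2) / 8)) (hgq : g < q) (hge : 2 * (q - g) < e + 2) :
    ∃ e', IsReducedParam D e' ∧ WeakConn D e e' ∧ |e' + 2| < |e + 2| := by
  have hg0 : 0 ≤ g := hg ▸ Int.natCast_nonneg _
  have he : (-e - 4) ^ 2 = (e + 4) ^ 2 := by ring
  have hl : (-e - 4 + 4 * q) ^ 2 < D :=
    sq_lt_of_between (a := -e - 4) (b := e + 4) (he ▸ H.2.1) H.2.1 (by linarith) (by linarith)
  obtain ⟨H', hs⟩ := sameConn_add (g := g) H.neg_sub (hg0.trans_lt hgq) hl (by rwa [he])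
  refine ⟨_, H', Or.inr ((conn_reducedProto_one H).trans_same hs), ?_⟩
  rw [abs_of_nonneg (a := e + 2) (by linarith), abs_lt]
  constructor <;> linarith

/-- Infinite descent on `|e + 2|`. -/
lemma weakConn_of_lower {D e₀ : ℤ}
    (h : ∀ e, -2 ≤ e → IsReducedParam D e → WeakConn D e e₀ ∨
      ∃ e', IsReducedParam D e' ∧ WeakConn D e e' ∧ |e' + 2| < |e + 2|) (e : ℤ)
    (H : IsReducedParam D e) : WeakConn D e e₀ := by
  induction hn : (e + 2).natAbs using Nat.strong_induction_on generalizing e with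
  | _ n ih =>
    wlog he : -2 ≤ e generalizing e
    · exact WeakConn.trans (Or.inr (conn_reducedProto_one H))
        (this _ H.neg_sub (by omega) (by omega))
    rcases h e he H with h' | ⟨e', H', hc, hlt⟩
    · exact h'
    · exact hc.trans (ih _ (hn ▸ by zify; exact hlt) e' H' rfl)

lemma emod_four_of_dvd {D e r : ℤ} (h : (8 : ℤ) ∣ D - e ^ 2)
    (hD : D % 8 = 2 * r) : e % 4 = r := by
  obtain ⟨k, hk⟩ := h
  obtain ⟨m, c, rfl, hc0, hc4⟩ : ∃ m c, e = 4 * m + c ∧ 0 ≤ c ∧ c < 4 :=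
    ⟨e / 4, e % 4, by omega, by omega, by omega⟩
  have : (4 * m + c) ^ 2 = 8 * (2 * m ^ 2 + m * c) + c ^ 2 := by ring
  rw [this] at hk
  generalize 2 * m ^ 2 + m * c = y at hk
  have hcases : c = 0 ∨ c = 1 ∨ c = 2 ∨ c = 3 := by omega
  rcases hcases with rfl | rfl | rfl | rfl <;> omega

lemma gcd_eq_one_of_prime {p u : ℤ} (hp : Prime p) (h : ¬ p ∣ u) : (1 : ℤ) = Int.gcd p u := by
  rw [Int.isCoprime_iff_gcd_eq_one.1 (hp.coprime_iff_not_dvd.2 h), Nat.cast_one]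

lemma two_eq_gcd_four {a : ℤ} : (2 : ℤ) = Int.gcd 4 (4 * a + 2) := by
  have h : Int.gcd (2 * 2) (2 * (2 * a + 1)) = 2 := by
    rw [Int.gcd_mul_left, Int.isCoprime_iff_gcd_eq_one.1 ⟨-a, 1, by ring⟩]
    rfl
  rw [show (4 * a + 2 : ℤ) = 2 * (2 * a + 1) by ring, show (4 : ℤ) = 2 * 2 by norm_num, h]
  rfl

lemma one_eq_gcd_of_eq_eight_mul_add {q m c u : ℤ} (hq : q = 2 * m + 1) (hc : c ∣ 2 ^ 4)
    (hu : u = 8 * q + c) : (1 : ℤ) = Int.gcd q u := by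
  have h : IsCoprime q 2 := ⟨1, -m, by rw [hq]; ring⟩
  have hqc : IsCoprime q c := (h.pow_right (n := 4)).of_isCoprime_of_dvd_right hc
  have : IsCoprime q (c + q * 8) := hqc.add_mul_left_right 8
  rw [hu, add_comm, mul_comm 8 q, Int.isCoprime_iff_gcd_eq_one.1 this, Nat.cast_one]

lemma gcd_two_mul_two_ne_one (i : ℤ) : Int.gcd (2 * i) 2 ≠ 1 := by
  have : (Int.gcd (2 * i) 2 : ℤ) = 2 := Int.gcd_eq_right (by norm_num) (dvd_mul_right _ _)
  omega

/-- The word `B_2 B_∞ B_1`. -/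
lemma flipConn_of_odd {D e a b : ℤ} (H : IsReducedParam D e)
    (H' : IsReducedParam D (-e - 8)) (ha : D = (e + 8) ^ 2 + 16 * (2 * a + 1))
    (hb : D = e ^ 2 + 16 * (2 * b + 1)) : FlipConn D e (-e - 8) := fun ε => by
  have P := isProto_reducedProto H
  have P' := isProto_reducedProto H'
  have h8 : (e + 8) ^ 2 < D := by
    linarith [show (-e - 8) ^ 2 = (e + 8) ^ 2 by ring, H'.1]
  have Q₁ : IsProto D (2 * a + 1, 2, 0, -e - 8) :=
    isProto_zero two_pos (by linarith) H'.1
      (by linarith [show (-e - 8 + 4 * 2) ^ 2 = e ^ 2 by ring, H.1])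
      (Int.isCoprime_iff_gcd_eq_one.1 ⟨1, -a, by ring⟩)
  have Q₂ : IsProto D (2 * b + 1, 2, 0, e) :=
    isProto_zero two_pos (by linarith) H.1 (by simpa using h8)
      (Int.isCoprime_iff_gcd_eq_one.1 ⟨1, -b, by ring⟩)
  have hw : (D - e ^ 2) / 8 = 2 * (2 * b + 1) := by omega
  have c₁ := conn_q 2 P Q₁ two_pos (by ring)
    (by simp only [mul_one, mul_zero, add_zero]; rw [hw, Int.gcd_eq_left] <;> omega) ε
  have c₂ := conn_inf Q₁ Q₂ (by ring) (by simp) (-ε)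
  have c₃ := conn_q 1 Q₂ P' one_pos (by ring) (by
    rw [Int.isCoprime_iff_gcd_eq_one.1 ⟨-b, 1, by ring⟩, Nat.cast_one]) (- -ε)
  rw [neg_neg] at c₂ c₃
  exact c₁.trans (c₂.trans c₃)

/-- The word `B_2 B_2 B_1`, when `D` is `36` modulo `64`. -/
lemma flipConn_of_thirty_six {D j : ℤ} (hj : 2 ≤ j) (hD : D = 64 * j + 36) :
    FlipConn D (-2) 2 := fun ε => by
  have P : IsProto D (reducedProto D (-2)) :=
    isProto_reducedProto ⟨by linarith, by linarith, 8 * j + 4, by linarith⟩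
  have P' : IsProto D (reducedProto D 2) :=
    isProto_reducedProto ⟨by linarith, by linarith, 8 * j + 4, by linarith⟩
  have Q₁ : IsProto D (2 * (2 * j), 2, 1, -6) :=
    isProto_one two_pos (by linarith) (by linarith) (by linarith) (gcd_two_mul_two_ne_one _)
  have Q₂ : IsProto D (2 * (2 * j - 2), 2, 1, -10) :=
    isProto_one two_pos (by linarith) (by linarith) (by linarith) (gcd_two_mul_two_ne_one _)
  have hw : (D - (-2) ^ 2) / 8 = 8 * j + 4 := by omega
  have c₁ := conn_q 2 P Q₁ two_pos (by norm_num)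
    (by simp only [mul_one, mul_zero, add_zero]; rw [hw, Int.gcd_eq_left] <;> omega) ε
  have c₂ := conn_q 2 Q₁ Q₂ two_pos (by norm_num) (by
    rw [show 2 * (2 * j) + 2 * 1 = 4 * j + 2 by ring]; exact two_eq_gcd_four) (-ε)
  have c₃ := conn_q 1 Q₂ P' one_pos (by norm_num) (by
    rw [Int.isCoprime_iff_gcd_eq_one.1 ⟨-(2 * (j - 1)), 1, by ring⟩, Nat.cast_one]) (- -ε)
  rw [neg_neg] at c₂ c₃
  exact c₁.trans (c₂.trans c₃)

/-- The word `B_2 B_2 B_1`, when `D` is `4` modulo `64`. -/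
lemma flipConn_of_sixty_eight {D j : ℤ} (hj : 1 ≤ j) (hD : D = 64 * j + 68) :
    FlipConn D (-2) (-6) := fun ε => by
  have P : IsProto D (reducedProto D (-2)) :=
    isProto_reducedProto ⟨by linarith, by linarith, 8 * j + 8, by linarith⟩
  have P' : IsProto D (reducedProto D (-6)) :=
    isProto_reducedProto ⟨by linarith, by linarith, 8 * j + 4, by linarith⟩
  have Q₁ : IsProto D (2 * (2 * j + 1), 2, 1, -6) :=
    isProto_one two_pos (by linarith) (by linarith) (by linarith) (gcd_two_mul_two_ne_one _)
  have hc : IsCoprime (2 * j - 1) (4 : ℤ) := by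
    have : IsCoprime (2 * j - 1) (2 : ℤ) := ⟨-1, j, by ring⟩
    simpa using this.pow_right (n := 2)
  have Q₂ : IsProto D (2 * j - 1, 4, 0, -10) :=
    isProto_zero (by norm_num) (by linarith) (by linarith) (by linarith)
      (Int.isCoprime_iff_gcd_eq_one.1 hc)
  have hw : (D - (-2) ^ 2) / 8 = 8 * j + 8 := by omega
  have c₁ := conn_q 2 P Q₁ two_pos (by norm_num)
    (by simp only [mul_one, mul_zero, add_zero]; rw [hw, Int.gcd_eq_left] <;> omega) ε
  have c₂ := conn_q 2 Q₁ Q₂ two_pos (by norm_num) (by rw [Int.gcd_eq_left] <;> omega) (-ε)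
  have c₃ := conn_q 1 Q₂ P' one_pos (by norm_num) (by
    simp only [one_mul, mul_zero, add_zero]
    rw [Int.isCoprime_iff_gcd_eq_one.1 hc.symm, Nat.cast_one]) (- -ε)
  rw [neg_neg] at c₂ c₃
  exact c₁.trans (c₂.trans c₃)

/-- All reduced prototypes are connected, with both signs. -/
def ReducedConnected (D : ℤ) : Prop :=
  ∃ e₀, IsReducedParam D e₀ ∧ FlipConn D e₀ e₀ ∧ ∀ e, IsReducedParam D e → WeakConn D e e₀

lemma reducedConnected_eight {D d : ℤ} (h16 : 16 < D) (hD : D = 16 * d + 8) :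
    ReducedConnected D := by
  have H0 : IsReducedParam D 0 := ⟨by linarith, by linarith, 2 * d + 1, by linarith⟩
  have hf : FlipConn D 0 (-4) := conn_reducedProto_one H0
  have h4 : IsReducedParam D (-4) := H0.neg_sub
  refine ⟨0, H0, ?_, weakConn_of_lower fun e he H => ?_⟩
  · have hw : (D - (-4) ^ 2) / 8 = 2 * d - 1 := by omega
    have := (sameConn_add (q := 2) (g := 1) h4 two_pos (by linarith)
      (by rw [hw]; exact gcd_eq_one_of_prime Int.prime_two (by omega))).2
    exact hf.trans_same this
  · have he4 := emod_four_of_dvd H.2.2 (r := 0) (by omega)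
    obtain ⟨x, rfl⟩ : ∃ x, e = 4 * x := ⟨e / 4, by omega⟩
    rcases eq_or_ne x 0 with rfl | hx
    · exact Or.inl (WeakConn.refl _ _)
    · right
      have hw : (D - (4 * x + 4) ^ 2) / 8 = 2 * (d - (x + 1) ^ 2) + 1 := by
        rw [hD, show 16 * d + 8 - (4 * x + 4) ^ 2 = 8 * (2 * (d - (x + 1) ^ 2) + 1) by ring]
        omega
      exact weakConn_lower (q := 2) (g := 1) H (by omega)
        (by rw [hw]; exact gcd_eq_one_of_prime Int.prime_two (by omega)) (by omega) (by omega)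

lemma flipConn_zero {D d : ℤ} (h16 : 16 < D) (hne : D ≠ 48) (hD : D = 16 * d) :
    FlipConn D 0 0 := by
  have H0 : IsReducedParam D 0 := ⟨by linarith, by linarith, 2 * d, by linarith⟩
  rcases Int.even_or_odd' d with ⟨c, rfl | rfl⟩
  · have hf : FlipConn D 0 (-4) := conn_reducedProto_one H0
    have h4 : IsReducedParam D (-4) := H0.neg_sub
    have := flipConn_of_odd (a := c - 1) (b := c - 1) h4 h4 (by linarith) (by linarith)
    exact (hf.trans this).trans_flip hf.symm
  · have hc : 2 ≤ c := by omega
    have H8 : IsReducedParam D (-8) :=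
      ⟨by linarith, by linarith, 2 * (2 * c + 1) - 8, by linarith⟩
    have h1 : FlipConn D 0 (-8) :=
      flipConn_of_odd (a := c - 2) (b := c) H0 H8 (by linarith) (by linarith)
    have hw : (D - (-8) ^ 2) / 8 = 4 * (c - 2) + 2 := by omega
    have h2 := (sameConn_add (q := 4) (g := 2) H8 (by norm_num) (by linarith)
      (by rw [hw]; exact two_eq_gcd_four)).2
    exact h1.trans_same h2

lemma reducedConnected_sixteen {D d : ℤ} (h16 : 16 < D) (hne : D ≠ 48) (hD : D = 16 * d) :
    ReducedConnected D := by
  refine ⟨0, ⟨by linarith, by linarith, 2 * d, by linarith⟩, flipConn_zero h16 hne hD,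
    weakConn_of_lower fun e he H => ?_⟩
  have he4 := emod_four_of_dvd H.2.2 (r := 0) (by omega)
  obtain ⟨x, rfl⟩ : ∃ x, e = 4 * x := ⟨e / 4, by omega⟩
  have hxd : (x + 1) ^ 2 < d := by
    have := H.2.1
    nlinarith
  rcases eq_or_ne x 0 with rfl | hx
  · exact Or.inl (WeakConn.refl _ _)
  right
  have hx1 : 1 ≤ x := by omega
  have hw : (D - (4 * x + 4) ^ 2) / 8 = 2 * (d - (x + 1) ^ 2) := by
    rw [hD, show 16 * d - (4 * x + 4) ^ 2 = 8 * (2 * (d - (x + 1) ^ 2)) by ring]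
    omega
  rcases Int.even_or_odd' (d - (x + 1) ^ 2) with ⟨s, hs | hs⟩
  · by_cases hlt : (x + 2) ^ 2 < d
    · have H' : IsReducedParam D (4 * x - 8) := by
        refine ⟨?_, ?_, 2 * d - 2 * (x - 2) ^ 2, by rw [hD]; ring⟩ <;> nlinarith
      have hw' : (D - (4 * x - 8) ^ 2) / 8 = 4 * (s + 3 * x - 2) + 2 := by
        rw [hD, show 16 * d - (4 * x - 8) ^ 2
          = 8 * (2 * (d - (x + 1) ^ 2) + 12 * x - 6) by ring, hs]
        omega
      have := (sameConn_add (q := 4) (g := 2) H' (by norm_num) (by nlinarith)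
        (by rw [hw']; exact two_eq_gcd_four)).2
      refine ⟨_, H', Or.inl ?_, ?_⟩
      · convert this.symm using 1
        ring
      · rw [abs_of_nonneg (a := 4 * x + 2) (by omega), abs_lt]
        omega
    · have hs0 : 1 ≤ s := by omega
      have hsx : s ≤ x + 1 := by nlinarith
      rcases hs0.eq_or_lt with rfl | hs1
      · refine weakConn_lower (q := 3) (g := 1) H (by omega) ?_ (by omega) (by omega)
        rw [hw, hs]
        exact gcd_eq_one_of_prime Int.prime_three (by norm_num)
      · refine weakConn_lower (q := 2 * s - 1) (g := 1) H (by omega) ?_ (by omega) (by omega)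
        rw [hw, hs, Int.isCoprime_iff_gcd_eq_one.1 ⟨2 * s - 1, -(s - 1), by ring⟩,
          Nat.cast_one]
  · refine weakConn_lower (q := 4) (g := 2) H (by omega) ?_ (by omega) (by omega)
    rw [hw, hs, show 2 * (2 * s + 1) = 4 * s + 2 by ring]
    exact two_eq_gcd_four

lemma weakConn_two {D n : ℤ} (hD : D = 8 * (2 * n) + 4) (h36 : 36 < D) (h68 : D ≠ 68)
    (h100 : D ≠ 100) : WeakConn D 2 (-2) := by
  have H : IsReducedParam D 2 := ⟨by linarith, by linarith, 2 * n, by linarith⟩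
  have H6 : IsReducedParam D (-6) := H.neg_sub
  have H2 : IsReducedParam D (-2) := ⟨by linarith, by linarith, 2 * n, by linarith⟩
  have h : FlipConn D 2 (-6) := conn_reducedProto_one H
  rcases Int.even_or_odd' n with ⟨m, rfl | rfl⟩
  · rcases Int.even_or_odd' m with ⟨j, rfl | rfl⟩
    · exact Or.inl (h.trans (flipConn_of_sixty_eight (j := j - 1) (by omega) (by linarith)).symm)
    · exact Or.inr (flipConn_of_thirty_six (j := j) (by omega) (by linarith)).symm
  · exact Or.inl (h.trans
      (flipConn_of_odd (a := m - 1) (b := m) H2 H6 (by linarith) (by linarith)).symm)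

lemma weakConn_of_eq_196 : WeakConn 196 6 (-2) := by
  refine Or.inl fun ε => ?_
  have P₀ : IsProto 196 (20, 1, 0, 6) := by
    apply isProto_zero <;> norm_num
  have P₁ : IsProto 196 (12, 1, 0, -10) := by
    apply isProto_zero <;> norm_num
  have P₂ : IsProto 196 (8, 3, 0, -2) := by
    apply isProto_zero <;> norm_num
  have P₃ : IsProto 196 (4, 3, 0, -10) := by
    apply isProto_zero <;> norm_num
  have P₄ : IsProto 196 (24, 1, 0, -2) := by
    apply isProto_zero <;> norm_num
  have c₁ := conn_inf P₀ P₁ (by norm_num) (by norm_num) ε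
  have c₂ := conn_q 3 P₁ P₂ (by norm_num) (by norm_num) (by norm_num) (-ε)
  have c₃ := conn_inf P₂ P₃ (by norm_num) (by norm_num) ε
  have c₄ := conn_q 1 P₃ P₄ (by norm_num) (by norm_num) (by norm_num) (-ε)
  rw [neg_neg] at c₂ c₄
  exact c₁.trans (c₂.trans (c₃.trans c₄))

lemma weakConn_of_eq_292 : WeakConn 292 6 (-2) := by
  refine Or.inr fun ε => ?_
  have P₀ : IsProto 292 (32, 1, 0, 6) := by
    apply isProto_zero <;> norm_num
  have P₁ : IsProto 292 (6, 2, 1, -14) := by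
    apply isProto_one <;> norm_num
  have P₂ : IsProto 292 (8, 3, 0, -10) := by
    apply isProto_zero <;> norm_num
  have P₃ : IsProto 292 (36, 1, 0, -2) := by
    apply isProto_zero <;> norm_num
  have c₁ := conn_q 2 P₀ P₁ (by norm_num) (by norm_num) (by norm_num) ε
  have c₂ := conn_q 3 P₁ P₂ (by norm_num) (by norm_num) (by norm_num) (-ε)
  have c₃ := conn_q 1 P₂ P₃ (by norm_num) (by norm_num) (by norm_num) ε
  rw [neg_neg] at c₂
  exact c₁.trans (c₂.trans c₃)

/-- Descent for parameters close to the upper end of the admissible range. -/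
lemma weakConn_lower_of_small {D k v : ℤ} (H : IsReducedParam D (4 * k - 2)) (hk : 3 ≤ k)
    (hw : (D - (4 * k - 2 + 4) ^ 2) / 8 = 12 * v) (hv : 1 ≤ v) (hvk : 12 * v ≤ 8 * k + 12) :
    ∃ e', IsReducedParam D e' ∧ WeakConn D (4 * k - 2) e' ∧
      |e' + 2| < |4 * k - 2 + 2| := by
  have main : ∀ q m c : ℤ, q = 2 * m + 1 → c ∣ 2 ^ 4 → 12 * v = 8 * q + c → 1 < q →
      q ≤ k + 3 → q < 2 * k + 1 → _ := fun q m c hq hc hu h1 h3 h2 =>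
    weakConn_lower (q := q) (g := 1) H (by omega)
      (by rw [hw]; exact one_eq_gcd_of_eq_eight_mul_add hq hc hu) h1 (by omega)
  have five : ¬ (5 : ℤ) ∣ 12 * v → _ := fun h =>
    weakConn_lower (q := 5) (g := 1) H (by omega)
      (by rw [hw]; exact gcd_eq_one_of_prime (by norm_num) h) (by norm_num) (by omega)
  obtain ⟨j, hj⟩ : ∃ j, v = 4 * j ∨ v = 4 * j + 1 ∨ v = 4 * j + 2 ∨ v = 4 * j + 3 :=
    ⟨v / 4, by omega⟩
  rcases hj with rfl | rfl | rfl | rfl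
  · exact main (6 * j - 1) (3 * j - 1) 8 (by ring) (by norm_num) (by ring) (by omega)
      (by omega) (by omega)
  · rcases eq_or_ne j 0 with rfl | hj
    · exact five (by norm_num)
    · exact main (6 * j + 1) (3 * j) 4 (by ring) (by norm_num) (by ring) (by omega)
        (by omega) (by omega)
  · rcases eq_or_ne j 0 with rfl | hj
    · exact five (by norm_num)
    · exact main (6 * j + 1) (3 * j) 16 (by ring) (by norm_num) (by ring) (by omega)
        (by omega) (by omega)
  · exact main (6 * j + 5) (3 * j + 2) (-4) (by ring) (by norm_num) (by ring) (by omega)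
      (by omega) (by omega)

/-- Descent when the value of `w` of the reflected parameter is divisible by `12`. -/
lemma weakConn_lower_of_dvd {D k v : ℤ} (H : IsReducedParam D (4 * k - 2)) (hk : 2 ≤ k)
    (hD : D = (4 * k + 2) ^ 2 + 8 * (12 * v)) (hlt : (4 * k + 10) ^ 2 < D) :
    ∃ e', IsReducedParam D e' ∧ WeakConn D (4 * k - 2) e' ∧
      |e' + 2| < |4 * k - 2 + 2| := by
  rw [abs_of_nonneg (a := 4 * k - 2 + 2) (by omega)]
  by_cases h3 : k % 3 = 2
  · have Hf : IsReducedParam D (-4 * k - 10) :=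
      ⟨by linarith [show (-4 * k - 10) ^ 2 = (4 * k + 10) ^ 2 by ring], by nlinarith,
        12 * v - 8 * k - 12, by linarith⟩
    have He : IsReducedParam D (-4 * k + 6) :=
      ⟨by nlinarith, by nlinarith, 12 * v + 8 * k - 4, by linarith⟩
    have hw : (D - (-4 * k - 10) ^ 2) / 8 = 12 * v - 8 * k - 12 := by
      rw [hD, show (4 * k + 2) ^ 2 + 8 * (12 * v) - (-4 * k - 10) ^ 2
        = 8 * (12 * v - 8 * k - 12) by ring]
      omega
    have c₁ := (sameConn_add (q := 3) (g := 1) Hf three_pos (by nlinarith)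
      (by rw [hw]; exact gcd_eq_one_of_prime Int.prime_three (by omega))).2
    have hw' : D - (-4 * k + 6) ^ 2 = 32 * (3 * v + 2 * k - 1) := by rw [hD]; ring
    have c₂ := sameConn_sub He ⟨-2 * k + 3, by ring⟩ (by nlinarith)
      (by convert Hf using 1; ring) ⟨_, hw'⟩ (by rw [hw']; omega)
    have c₃ := conn_reducedProto_one H
    rw [show -4 * k - 10 + 4 * (3 - 1) = -(4 * k - 2) - 4 by ring] at c₁
    rw [show -4 * k + 6 - 16 = -4 * k - 10 by ring] at c₂
    refine ⟨_, He, Or.inr (c₃.trans_same (c₁.symm.trans c₂.symm)), ?_⟩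
    rw [abs_lt]
    omega
  · have hw' : D - (4 * k - 2) ^ 2 = 32 * (3 * v + k) := by rw [hD]; ring
    have hk' : 3 ≤ k := by omega
    have He : IsReducedParam D (4 * k - 2 - 16) :=
      ⟨by nlinarith, by nlinarith, 12 * v + 20 * k - 40, by rw [hD]; ring⟩
    refine ⟨_, He, Or.inl (sameConn_sub H ⟨2 * k - 1, by ring⟩ (by nlinarith) He
      ⟨_, hw'⟩ (by rw [hw']; omega)), ?_⟩
    rw [abs_lt]
    omega

lemma reducedConnected_four {D n : ℤ} (h16 : 16 < D) (h68 : D ≠ 68) (h100 : D ≠ 100)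
    (hD : D = 8 * n + 4) : ReducedConnected D := by
  have H2 : IsReducedParam D (-2) := ⟨by linarith, by linarith, n, by linarith⟩
  refine ⟨-2, H2, conn_reducedProto_one H2, weakConn_of_lower fun e he H => ?_⟩
  have he4 := emod_four_of_dvd H.2.2 (r := 2) (by omega)
  obtain ⟨k, rfl⟩ : ∃ k, e = 4 * k - 2 := ⟨(e + 2) / 4, by omega⟩
  obtain ⟨p, hp⟩ : ∃ p, k * (k + 1) = 2 * p := (Int.even_mul_succ_self k).two_dvd
  have hDk : D = (4 * k + 2) ^ 2 + 8 * (n - 4 * p) := by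
    rw [hD]; linear_combination -16 * hp
  have hw : (D - (4 * k - 2 + 4) ^ 2) / 8 = n - 4 * p := by
    rw [hDk, show (4 * k + 2) ^ 2 + 8 * (n - 4 * p) - (4 * k - 2 + 4) ^ 2
      = 8 * (n - 4 * p) by ring]
    omega
  rcases eq_or_ne k 0 with rfl | hk0
  · exact Or.inl (WeakConn.refl _ _)
  by_cases hodd : n % 2 = 1
  · exact Or.inr (weakConn_lower (q := 2) (g := 1) H (by omega)
      (by rw [hw]; exact gcd_eq_one_of_prime Int.prime_two (by omega)) (by omega) (by omega))
  obtain ⟨m, rfl⟩ : ∃ m, n = 2 * m := ⟨n / 2, by omega⟩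
  rcases eq_or_ne k 1 with rfl | hk1
  · exact Or.inl (weakConn_two hD (by have := H.2.1; norm_num at this; exact this) h68 h100)
  have hk : 2 ≤ k := by omega
  rcases Int.even_or_odd' m with ⟨i, rfl | rfl⟩
  swap
  · refine Or.inr (weakConn_lower (q := 4) (g := 2) H (by omega) ?_ (by omega) (by omega))
    rw [hw, show 2 * (2 * i + 1) - 4 * p = 4 * (i - p) + 2 by ring]
    exact two_eq_gcd_four
  by_cases h3 : (3 : ℤ) ∣ i - p
  swap
  · refine Or.inr (weakConn_lower (q := 3) (g := 1) H (by omega) ?_ (by omega) (by omega))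
    rw [hw]
    exact gcd_eq_one_of_prime Int.prime_three (by omega)
  obtain ⟨v, hv⟩ := h3
  have hv' : 2 * (2 * i) - 4 * p = 12 * v := by linarith
  rw [hv'] at hDk hw
  by_cases hlt : (4 * k + 10) ^ 2 < D
  · exact Or.inr (weakConn_lower_of_dvd H hk hDk hlt)
  have hv1 : 1 ≤ v := by
    have := H.2.1
    nlinarith
  have hvk : 12 * v ≤ 8 * k + 12 := by nlinarith
  rcases hk.eq_or_lt with rfl | hk3
  · left
    have : v = 1 ∨ v = 2 := by omega
    rcases this with rfl | rfl
    · norm_num at hDk ⊢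
      rw [hDk]
      exact weakConn_of_eq_196
    · norm_num at hDk ⊢
      rw [hDk]
      exact weakConn_of_eq_292
  · exact Or.inr (weakConn_lower_of_small H hk3 hw hv1 hvk)

lemma conn_of_reducedConnected {D : ℤ} (h : ReducedConnected D) :
    (∃ x, IsProtoQ D x) ∧
    ∀ x, IsProtoQ D x → ∀ y, IsProtoQ D y → Relation.EqvGen (QMove D) x y := by
  obtain ⟨e₀, H₀, hf, hc⟩ := h
  refine ⟨⟨(reducedProto D e₀, 1), isProto_reducedProto H₀, Or.inl rfl⟩, ?_⟩
  have key : ∀ x, IsProtoQ D x → Conn D x (reducedProto D e₀, 1) := by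
    rintro ⟨⟨w, h, t, e⟩, ε⟩ ⟨hx, hε⟩
    have both : ∀ δ, (δ = 1 ∨ δ = -1) →
        Conn D (reducedProto D e₀, δ) (reducedProto D e₀, 1) := by
      rintro δ (rfl | rfl)
      · exact Conn.refl _
      · exact hf (-1)
    obtain ⟨e', H', hc'⟩ := exists_conn_reducedProto h.toNat w h t e ε (by simp) hx
    simp only at hε
    rcases hc e' H' with hs | hs <;> rcases hc' with h1 | h1
    · exact h1.trans ((hs _).trans (both _ hε))
    · exact h1.trans ((hs _).trans (both _ (by omega)))
    · exact h1.trans ((hs _).trans (both _ (by omega)))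
    · exact h1.trans ((hs _).trans (both _ (by omega)))
  exact fun x hx y hy => (key x hx).trans (key y hy).symm

/-- For even `D > 16` with `D ≡ 0, 4 (mod 8)` and `D ∉ {48, 68, 100}`, the set `𝒬_D`
has exactly one component. -/
theorem stmt12 (D : ℤ) (h16 : 16 < D) (hmod : D % 8 = 0 ∨ D % 8 = 4)
    (hexc : D ∉ ({48, 68, 100} : Set ℤ)) :
    (∃ x, IsProtoQ D x) ∧
    ∀ x, IsProtoQ D x → ∀ y, IsProtoQ D y → Relation.EqvGen (QMove D) x y := by
  simp only [Set.mem_insert_iff, Set.mem_singleton_iff, not_or] at hexc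
  obtain ⟨h48, h68, h100⟩ := hexc
  apply conn_of_reducedConnected
  have hcases : D = 16 * (D / 16) ∨ D = 16 * (D / 16) + 8 ∨ D = 8 * (D / 8) + 4 := by omega
  rcases hcases with h | h | h
  · exact reducedConnected_sixteen h16 h48 h
  · exact reducedConnected_eight h16 h
  · exact reducedConnected_four h16 h68 h100 h
end
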